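/- There exists a constant C > 0, depending only on the data (u_T, m₀, L, T, σ, r, ε), such that every smooth solution (u,m) of the MFG system satisfies |∫₀^L u_x(t,x) m(t,x) dx| ≤ C for all t ∈ [0,T]. -/

import Mathlib

open Set MeasureTheory intervalIntegral Function

noncomputable section

/-- Spatial derivative `u_x`. -/
def pdx (u : ℝ → ℝ → ℝ) (t x : ℝ) : ℝ := deriv (u t) x

/-- Second spatial derivative `u_xx`. -/
def pdxx (u : ℝ → ℝ → ℝ) (t x : ℝ) : ℝ := deriv (deriv (u t)) x

/-- Time derivative `u_t`. -/
def pdt (u : ℝ → ℝ → ℝ) (t x : ℝ) : ℝ := deriv (fun s => u s x) t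

/-- `η(t) = ∫₀^L m(t,x) dx`. -/
def mfgEta (L : ℝ) (m : ℝ → ℝ → ℝ) (t : ℝ) : ℝ := ∫ x in (0:ℝ)..L, m t x

/-- `f(t) = a(η(t)) + c(η(t)) p̄(t)`. -/
def mfgF (L ε : ℝ) (u m : ℝ → ℝ → ℝ) (t : ℝ) : ℝ :=
  2 / (2 + ε * mfgEta L m t)
    + (ε / (2 + ε * mfgEta L m t)) * ∫ x in (0:ℝ)..L, pdx u t x * m t x

/-- `G(t,x) = (1/2)(f(t) − u_x(t,x))`. -/
def mfgG (L ε : ℝ) (u m : ℝ → ℝ → ℝ) (t x : ℝ) : ℝ :=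
  (1/2) * (mfgF L ε u m t - pdx u t x)

/-- `H(t,x) = G(t,x)²`. -/
def mfgH (L ε : ℝ) (u m : ℝ → ℝ → ℝ) (t x : ℝ) : ℝ := (mfgG L ε u m t x)^2

/-- Standing assumptions on the data. -/
structure MFGData (T L σ r ε : ℝ) (uT m0 : ℝ → ℝ) : Prop where
  hT : 0 < T
  hL : 0 < L
  hσ : 0 < σ
  hr : 0 < r
  hε : 0 ≤ ε
  uT_smooth : ContDiff ℝ 2 uT
  m0_smooth : ContDiff ℝ 2 m0
  uT_zero : uT 0 = 0
  uT_deriv_L : deriv uT L = 0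
  uT_nonneg : ∀ x ∈ Icc (0:ℝ) L, 0 ≤ uT x
  uT_deriv_nonneg : ∀ x ∈ Icc (0:ℝ) L, 0 ≤ deriv uT x
  m0_zero : m0 0 = 0
  m0_L : m0 L = 0
  m0_deriv_L : deriv m0 L = 0
  m0_nonneg : ∀ x ∈ Icc (0:ℝ) L, 0 ≤ m0 x
  m0_mass : (∫ x in (0:ℝ)..L, m0 x) = 1

/-- A smooth solution of the MFG system \eqref{main system}. -/
structure IsMFGSolution (T L σ r ε : ℝ) (uT m0 : ℝ → ℝ) (u m : ℝ → ℝ → ℝ) : Prop where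
  u_smooth : ContDiff ℝ (⊤ : ℕ∞) (uncurry u)
  m_smooth : ContDiff ℝ (⊤ : ℕ∞) (uncurry m)
  hjb : ∀ t ∈ Ioo (0:ℝ) T, ∀ x ∈ Ioo (0:ℝ) L,
    pdt u t x + σ^2/2 * pdxx u t x - r * u t x + mfgH L ε u m t x = 0
  fp : ∀ t ∈ Ioo (0:ℝ) T, ∀ x ∈ Ioo (0:ℝ) L,
    pdt m t x - σ^2/2 * pdxx m t x
      - deriv (fun y => mfgG L ε u m t y * m t y) x = 0
  m_init : ∀ x ∈ Icc (0:ℝ) L, m 0 x = m0 x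
  u_term : ∀ x ∈ Icc (0:ℝ) L, u T x = uT x
  u_bdry : ∀ t ∈ Icc (0:ℝ) T, u t 0 = 0
  m_bdry : ∀ t ∈ Icc (0:ℝ) T, m t 0 = 0
  ux_bdry : ∀ t ∈ Icc (0:ℝ) T, pdx u t L = 0
  m_flux : ∀ t ∈ Icc (0:ℝ) T,
    σ^2/2 * pdx m t L + mfgG L ε u m t L * m t L = 0

end

section SmoothFamilies

variable {g h : ℝ → ℝ → ℝ}

theorem hasDerivAt_pdx (hg : ContDiff ℝ (⊤ : ℕ∞) (uncurry g)) (t x : ℝ) :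
    HasDerivAt (g t) (pdx g t x) x := by
  have h1 : ContDiff ℝ (⊤ : ℕ∞) (fun y => uncurry g (t, y)) :=
    hg.comp (contDiff_const.prodMk contDiff_id)
  exact (h1.differentiable (by simp) x).hasDerivAt

theorem hasDerivAt_pdt (hg : ContDiff ℝ (⊤ : ℕ∞) (uncurry g)) (t x : ℝ) :
    HasDerivAt (fun s => g s x) (pdt g t x) t := by
  have h1 : ContDiff ℝ (⊤ : ℕ∞) (fun y => uncurry g (y, x)) :=
    hg.comp (contDiff_id.prodMk contDiff_const)
  exact (h1.differentiable (by simp) t).hasDerivAt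

theorem pdx_eq_fderiv (hg : ContDiff ℝ (⊤ : ℕ∞) (uncurry g)) (t x : ℝ) :
    pdx g t x = fderiv ℝ (uncurry g) (t, x) (0, 1) := by
  have h1 := (hg.differentiable (by simp) (t, x)).hasFDerivAt
  have h2 : HasDerivAt (fun y : ℝ => (t, y)) ((0 : ℝ), (1 : ℝ)) x :=
    (hasDerivAt_const x t).prodMk (hasDerivAt_id x)
  exact (h1.comp_hasDerivAt x h2).deriv

theorem pdt_eq_fderiv (hg : ContDiff ℝ (⊤ : ℕ∞) (uncurry g)) (t x : ℝ) :
    pdt g t x = fderiv ℝ (uncurry g) (t, x) (1, 0) := by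
  have h1 := (hg.differentiable (by simp) (t, x)).hasFDerivAt
  have h2 : HasDerivAt (fun y : ℝ => (y, x)) ((1 : ℝ), (0 : ℝ)) t :=
    (hasDerivAt_id t).prodMk (hasDerivAt_const t x)
  exact (h1.comp_hasDerivAt t h2).deriv

theorem contDiff_pdx (hg : ContDiff ℝ (⊤ : ℕ∞) (uncurry g)) :
    ContDiff ℝ (⊤ : ℕ∞) (uncurry (pdx g)) := by
  have h1 : uncurry (pdx g) = fun p => fderiv ℝ (uncurry g) p (0, 1) := by
    ext ⟨t, x⟩
    exact pdx_eq_fderiv hg t x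
  rw [h1]
  exact (hg.fderiv_right (m := (⊤ : ℕ∞)) (by simp)).clm_apply contDiff_const

theorem contDiff_pdt (hg : ContDiff ℝ (⊤ : ℕ∞) (uncurry g)) :
    ContDiff ℝ (⊤ : ℕ∞) (uncurry (pdt g)) := by
  have h1 : uncurry (pdt g) = fun p => fderiv ℝ (uncurry g) p (1, 0) := by
    ext ⟨t, x⟩
    exact pdt_eq_fderiv hg t x
  rw [h1]
  exact (hg.fderiv_right (m := (⊤ : ℕ∞)) (by simp)).clm_apply contDiff_const

theorem pdxx_eq_pdx_pdx (g : ℝ → ℝ → ℝ) (t x : ℝ) : pdxx g t x = pdx (pdx g) t x := rfl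

theorem contDiff_pdxx (hg : ContDiff ℝ (⊤ : ℕ∞) (uncurry g)) :
    ContDiff ℝ (⊤ : ℕ∞) (uncurry (pdxx g)) :=
  contDiff_pdx (contDiff_pdx hg)

theorem hasDerivAt_pdxx (hg : ContDiff ℝ (⊤ : ℕ∞) (uncurry g)) (t x : ℝ) :
    HasDerivAt (pdx g t) (pdxx g t x) x :=
  hasDerivAt_pdx (contDiff_pdx hg) t x

theorem pdx_pdt_comm (hg : ContDiff ℝ (⊤ : ℕ∞) (uncurry g)) (t x : ℝ) :
    pdx (pdt g) t x = pdt (pdx g) t x := by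
  have hs : IsSymmSndFDerivAt ℝ (uncurry g) (t, x) :=
    hg.contDiffAt.isSymmSndFDerivAt (by
      simpa using WithTop.coe_le_coe.2 (le_top : (2 : ℕ∞) ≤ ⊤))
  have hd : DifferentiableAt ℝ (fderiv ℝ (uncurry g)) (t, x) :=
    (hg.fderiv_right (m := (⊤ : ℕ∞)) (by simp)).differentiable (by simp) _
  have h1 : uncurry (pdx g) = fun p => fderiv ℝ (uncurry g) p (0, 1) := by
    ext ⟨t, x⟩
    exact pdx_eq_fderiv hg t x
  have h2 : uncurry (pdt g) = fun p => fderiv ℝ (uncurry g) p (1, 0) := by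
    ext ⟨t, x⟩
    exact pdt_eq_fderiv hg t x
  rw [pdx_eq_fderiv (contDiff_pdt hg), pdt_eq_fderiv (contDiff_pdx hg), h1, h2,
    fderiv_clm_apply hd (differentiableAt_const _), fderiv_clm_apply hd (differentiableAt_const _)]
  simpa using hs (0, 1) (1, 0)

theorem continuous_space (hg : ContDiff ℝ (⊤ : ℕ∞) (uncurry g)) (t : ℝ) : Continuous (g t) :=
  hg.continuous.comp (Continuous.prodMk_right t)

theorem continuous_integral (hg : Continuous (uncurry g)) (L : ℝ) :
    Continuous fun t => ∫ x in (0:ℝ)..L, g t x :=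
  intervalIntegral.continuous_parametric_intervalIntegral_of_continuous' hg _ _

theorem hasDerivAt_integral (hg : ContDiff ℝ (⊤ : ℕ∞) (uncurry g)) (L t : ℝ) :
    HasDerivAt (fun s => ∫ x in (0:ℝ)..L, g s x) (∫ x in (0:ℝ)..L, pdt g t x) t := by
  obtain ⟨C, hC⟩ := ((isCompact_Icc (a := t - 1) (b := t + 1)).prod
    (isCompact_uIcc (a := (0:ℝ)) (b := L))).exists_bound_of_continuousOn
    (contDiff_pdt hg).continuous.continuousOn
  refine (intervalIntegral.hasDerivAt_integral_of_dominated_loc_of_deriv_le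
    (F := g) (F' := pdt g) (bound := fun _ => C) (s := Icc (t - 1) (t + 1))
    (Icc_mem_nhds (by linarith) (by linarith)) ?_ ?_ ?_ ?_ ?_ ?_).2
  · exact Filter.Eventually.of_forall fun s => (continuous_space hg s).aestronglyMeasurable
  · exact (continuous_space hg t).intervalIntegrable _ _
  · exact (continuous_space (contDiff_pdt hg) t).aestronglyMeasurable
  · exact Filter.Eventually.of_forall fun x hx s hs => hC (s, x) ⟨hs, uIoc_subset_uIcc hx⟩
  · exact continuous_const.intervalIntegrable _ _
  · exact Filter.Eventually.of_forall fun x _ s _ => hasDerivAt_pdt hg s x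

theorem contDiff_exp_mul (hg : ContDiff ℝ (⊤ : ℕ∞) (uncurry g)) (k l : ℝ) :
    ContDiff ℝ (⊤ : ℕ∞) (uncurry fun t x => Real.exp (k * x + l * t) * g t x) :=
  (Real.contDiff_exp.comp ((contDiff_const.mul contDiff_snd).add
    (contDiff_const.mul contDiff_fst))).mul hg

theorem pdx_exp_mul (hg : ContDiff ℝ (⊤ : ℕ∞) (uncurry g)) (k l t x : ℝ) :
    pdx (fun t x => Real.exp (k * x + l * t) * g t x) t x =
      Real.exp (k * x + l * t) * (k * g t x + pdx g t x) := by
  have h1 : HasDerivAt (fun y => Real.exp (k * y + l * t)) (k * Real.exp (k * x + l * t)) x := by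
    simpa [mul_comm] using (((hasDerivAt_id x).const_mul k).add_const (l * t)).exp
  exact ((h1.mul (hasDerivAt_pdx hg t x)).congr_deriv (by ring)).deriv

theorem pdxx_exp_mul (hg : ContDiff ℝ (⊤ : ℕ∞) (uncurry g)) (k l t x : ℝ) :
    pdxx (fun t x => Real.exp (k * x + l * t) * g t x) t x =
      Real.exp (k * x + l * t) * (k ^ 2 * g t x + 2 * k * pdx g t x + pdxx g t x) := by
  have h1 : ContDiff ℝ (⊤ : ℕ∞) (uncurry fun t x => k * g t x + pdx g t x) :=
    (contDiff_const.mul hg).add (contDiff_pdx hg)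
  have h2 : pdx (fun t x => k * g t x + pdx g t x) t x = k * pdx g t x + pdxx g t x :=
    (((hasDerivAt_pdx hg t x).const_mul k).add (hasDerivAt_pdxx hg t x)).deriv
  have h3 := pdx_exp_mul h1 k l t x
  rw [h2] at h3
  have h4 : pdx (fun t x => Real.exp (k * x + l * t) * g t x) =
      fun t x => Real.exp (k * x + l * t) * (k * g t x + pdx g t x) := by
    ext t x
    exact pdx_exp_mul hg k l t x
  rw [pdxx_eq_pdx_pdx, h4, h3]
  ring

theorem pdt_exp_mul (hg : ContDiff ℝ (⊤ : ℕ∞) (uncurry g)) (k l t x : ℝ) :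
    pdt (fun t x => Real.exp (k * x + l * t) * g t x) t x =
      Real.exp (k * x + l * t) * (l * g t x + pdt g t x) := by
  have h1 : HasDerivAt (fun s => Real.exp (k * x + l * s)) (l * Real.exp (k * x + l * t)) t := by
    simpa [mul_comm] using (((hasDerivAt_id t).const_mul l).const_add (k * x)).exp
  exact ((h1.mul (hasDerivAt_pdt hg t x)).congr_deriv (by ring)).deriv

end SmoothFamilies

theorem nonneg_deriv_of_left_min {g : ℝ → ℝ} {d a b : ℝ} (hab : a < b) (hd : HasDerivAt g d a)
    (hmin : ∀ x ∈ Icc a b, g a ≤ g x) : 0 ≤ d := by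
  refine ge_of_tendsto (hd.tendsto_slope.mono_left (nhdsGT_le_nhdsNE a)) ?_
  filter_upwards [Ioo_mem_nhdsGT hab] with x hx
  rw [slope_def_field]
  exact div_nonneg (sub_nonneg.2 (hmin x (Ioo_subset_Icc_self hx))) (sub_nonneg.2 hx.1.le)

theorem nonpos_deriv_of_right_min {g : ℝ → ℝ} {d a b : ℝ} (hab : a < b) (hd : HasDerivAt g d b)
    (hmin : ∀ x ∈ Icc a b, g b ≤ g x) : d ≤ 0 := by
  refine le_of_tendsto (hd.tendsto_slope.mono_left (nhdsLT_le_nhdsNE b)) ?_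
  filter_upwards [Ioo_mem_nhdsLT hab] with x hx
  rw [slope_def_field]
  exact div_nonpos_of_nonneg_of_nonpos (sub_nonneg.2 (hmin x (Ioo_subset_Icc_self hx)))
    (sub_nonpos.2 hx.2.le)

theorem IsLocalMin.deriv_deriv_nonneg {g : ℝ → ℝ} {x : ℝ} (hmin : IsLocalMin g x)
    (hc : ContinuousAt g x) : 0 ≤ deriv (deriv g) x := by
  by_contra! hneg
  have hmax : IsLocalMax g x := isLocalMax_of_deriv_deriv_neg hneg hmin.deriv_eq_zero hc
  have heq : g =ᶠ[nhds x] fun _ => g x := by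
    filter_upwards [hmin, hmax] with y h1 h2 using le_antisymm h2 h1
  rw [heq.deriv.deriv_eq] at hneg
  simp at hneg

/-- Minimum principle for a forward parabolic inequality on a box. -/
theorem forward_min_principle {T L : ℝ} (hT : 0 < T) (hL : 0 < L) {w : ℝ → ℝ → ℝ}
    (hw : ContDiff ℝ (⊤ : ℕ∞) (uncurry w))
    (hinit : ∀ x ∈ Icc 0 L, 0 ≤ w 0 x) (hzero : ∀ t ∈ Icc 0 T, 0 ≤ w t 0)
    (hright : ∀ t ∈ Icc 0 T, w t L < 0 → 0 < pdx w t L)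
    (hinterior : ∀ t ∈ Icc 0 T, ∀ x ∈ Ioo 0 L, w t x < 0 → pdx w t x = 0 → 0 ≤ pdxx w t x →
      pdt w t x ≤ 0 → False) :
    ∀ t ∈ Icc 0 T, ∀ x ∈ Icc 0 L, 0 ≤ w t x := by
  obtain ⟨⟨t₀, x₀⟩, ⟨ht₀, hx₀⟩, hmin⟩ := ((isCompact_Icc (a := (0:ℝ)) (b := T)).prod
    (isCompact_Icc (a := (0:ℝ)) (b := L))).exists_isMinOn
    ⟨(0, 0), left_mem_Icc.2 hT.le, left_mem_Icc.2 hL.le⟩ hw.continuous.continuousOn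
  have hle : ∀ t ∈ Icc 0 T, ∀ x ∈ Icc 0 L, w t₀ x₀ ≤ w t x := fun t ht x hx =>
    hmin (mk_mem_prod ht hx)
  suffices 0 ≤ w t₀ x₀ from fun t ht x hx => this.trans (hle t ht x hx)
  by_contra! hneg
  have ht0 : 0 < t₀ := by
    refine lt_of_le_of_ne ht₀.1 fun h => ?_
    rw [← h] at hneg
    exact (hinit x₀ hx₀).not_gt hneg
  have hx0 : 0 < x₀ := by
    refine lt_of_le_of_ne hx₀.1 fun h => ?_
    rw [← h] at hneg
    exact (hzero t₀ ht₀).not_gt hneg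
  have hxL : x₀ < L := by
    refine lt_of_le_of_ne hx₀.2 fun h => ?_
    subst h
    exact (hright t₀ ht₀ hneg).not_ge
      (nonpos_deriv_of_right_min hL (hasDerivAt_pdx hw t₀ x₀) (hle t₀ ht₀))
  have hloc : IsLocalMin (w t₀) x₀ := by
    filter_upwards [Icc_mem_nhds hx0 hxL] with x hx using hle t₀ ht₀ x hx
  refine hinterior t₀ ht₀ x₀ ⟨hx0, hxL⟩ hneg hloc.deriv_eq_zero
    (hloc.deriv_deriv_nonneg (continuous_space hw t₀).continuousAt) ?_
  exact nonpos_deriv_of_right_min ht0 (hasDerivAt_pdt hw t₀ x₀)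
    fun t ht => hle t ⟨ht.1, ht.2.trans ht₀.2⟩ x₀ hx₀

/-- Minimum principle for a backward parabolic inequality on a box. -/
theorem backward_min_principle {T L : ℝ} (hT : 0 < T) (hL : 0 < L) {w : ℝ → ℝ → ℝ}
    (hw : ContDiff ℝ (⊤ : ℕ∞) (uncurry w))
    (hterm : ∀ x ∈ Icc 0 L, 0 ≤ w T x) (hzero : ∀ t ∈ Icc 0 T, 0 ≤ w t 0)
    (hright : ∀ t ∈ Icc 0 T, w t L < 0 → 0 < pdx w t L)
    (hinterior : ∀ t ∈ Icc 0 T, ∀ x ∈ Ioo 0 L, w t x < 0 → pdx w t x = 0 → 0 ≤ pdxx w t x →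
      0 ≤ pdt w t x → False) :
    ∀ t ∈ Icc 0 T, ∀ x ∈ Icc 0 L, 0 ≤ w t x := by
  have hmem : ∀ t ∈ Icc 0 T, T - t ∈ Icc 0 T := fun t ht =>
    ⟨by linarith [ht.2], by linarith [ht.1]⟩
  have hw' : ContDiff ℝ (⊤ : ℕ∞) (uncurry fun t x => w (T - t) x) :=
    hw.comp ((contDiff_const.sub contDiff_fst).prodMk contDiff_snd)
  have key := forward_min_principle hT hL hw' (by simpa using hterm)
    (fun t ht => hzero _ (hmem t ht)) (fun t ht => hright _ (hmem t ht))
    (fun t ht x hx h1 h2 h3 h4 => hinterior (T - t) (hmem t ht) x hx h1 h2 h3 (by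
      have : HasDerivAt (fun s => w (T - s) x) (-pdt w (T - t) x) t :=
        (hasDerivAt_pdt hw (T - t) x).comp_const_sub T t
      have h5 : pdt (fun t x => w (T - t) x) t x = -pdt w (T - t) x := this.deriv
      linarith))
  intro t ht x hx
  simpa using key (T - t) (hmem t ht) x hx

theorem eq_zero_on_closed_box {T L : ℝ} (hT : 0 < T) (hL : 0 < L) {Z : ℝ → ℝ → ℝ}
    (hZ : ContinuousOn (uncurry Z) (Icc 0 T ×ˢ Icc 0 L))
    (h0 : ∀ t ∈ Ioo 0 T, ∀ x ∈ Ioo 0 L, Z t x = 0) :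
    ∀ t ∈ Icc 0 T, ∀ x ∈ Icc 0 L, Z t x = 0 := by
  have h1 : EqOn (uncurry Z) (fun _ => 0) (Ioo 0 T ×ˢ Ioo 0 L) := fun p hp =>
    h0 p.1 hp.1 p.2 hp.2
  have h2 := h1.of_subset_closure hZ continuousOn_const
    (prod_mono Ioo_subset_Icc_self Ioo_subset_Icc_self)
    (by rw [closure_prod_eq, closure_Ioo hT.ne, closure_Ioo hL.ne])
  exact fun t ht x hx => h2 (mk_mem_prod ht hx)

/-- Nonnegativity of the density for a Fokker-Planck equation with a flux condition at `L`. -/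
theorem density_nonneg {T L σ : ℝ} (hT : 0 < T) (hL : 0 < L) (hσ : 0 < σ) {u m : ℝ → ℝ → ℝ}
    {f : ℝ → ℝ} (hu : ContDiff ℝ (⊤ : ℕ∞) (uncurry u)) (hm : ContDiff ℝ (⊤ : ℕ∞) (uncurry m))
    (hf : ContinuousOn f (Icc 0 T))
    (hfp : ∀ t ∈ Icc 0 T, ∀ x ∈ Icc 0 L, pdt m t x - σ^2/2 * pdxx m t x
      + 1/2 * pdxx u t x * m t x - 1/2 * (f t - pdx u t x) * pdx m t x = 0)
    (hinit : ∀ x ∈ Icc 0 L, 0 ≤ m 0 x) (hzero : ∀ t ∈ Icc 0 T, m t 0 = 0)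
    (hflux : ∀ t ∈ Icc 0 T,
      σ^2/2 * pdx m t L + 1/2 * (f t - pdx u t L) * m t L = 0) :
    ∀ t ∈ Icc 0 T, ∀ x ∈ Icc 0 L, 0 ≤ m t x := by
  have hf' : ContinuousOn (fun p : ℝ × ℝ => f p.1) (Icc 0 T ×ˢ Icc 0 L) :=
    hf.comp continuousOn_fst fun p hp => hp.1
  have hbox : IsCompact (Icc (0:ℝ) T ×ˢ Icc (0:ℝ) L) := isCompact_Icc.prod isCompact_Icc
  have hux : Continuous fun p : ℝ × ℝ => pdx u p.1 p.2 := (contDiff_pdx hu).continuous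
  have huxx : Continuous fun p : ℝ × ℝ => pdxx u p.1 p.2 := (contDiff_pdxx hu).continuous
  obtain ⟨B, hB⟩ := hbox.exists_bound_of_continuousOn (f := fun p : ℝ × ℝ => f p.1 - pdx u p.1 p.2)
    (hf'.sub hux.continuousOn)
  obtain ⟨k, hk⟩ : ∃ k : ℝ, k * σ^2 = -(B + 1) := ⟨-(B + 1) / σ^2, by field_simp⟩
  obtain ⟨l, hl⟩ := hbox.exists_bound_of_continuousOn
    (f := fun p : ℝ × ℝ => σ^2/2 * k^2 - 1/2 * pdxx u p.1 p.2 - k * (1/2 * (f p.1 - pdx u p.1 p.2)))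
    ((continuousOn_const.sub (continuousOn_const.mul huxx.continuousOn)).sub
      (continuousOn_const.mul (continuousOn_const.mul (hf'.sub hux.continuousOn))))
  have hneg : ∀ t x, Real.exp (k * x + -(l + 1) * t) * m t x < 0 → m t x < 0 := fun t x h => by
    by_contra! h'
    exact (mul_nonneg (Real.exp_pos _).le h').not_gt h
  have key := forward_min_principle hT hL (contDiff_exp_mul hm k (-(l + 1)))
    (fun x hx => mul_nonneg (Real.exp_pos _).le (hinit x hx))
    (fun t ht => by simp [hzero t ht]) ?_ ?_
  · intro t ht x hx
    exact nonneg_of_mul_nonneg_right (key t ht x hx) (Real.exp_pos _)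
  · intro t ht h
    have hm' := hneg _ _ h
    rw [pdx_exp_mul hm]
    refine mul_pos (Real.exp_pos _) ?_
    have h1 := hflux t ht
    have h2 := (abs_le.1 (hB (t, L) ⟨ht, right_mem_Icc.2 hL.le⟩)).1
    simp only at h2
    have h3 : 0 < σ^2 := by positivity
    have h4 : σ^2 * (k * m t L + pdx m t L) = (k * σ^2 - (f t - pdx u t L)) * m t L := by
      linarith
    have h5 : 0 < (k * σ^2 - (f t - pdx u t L)) * m t L :=
      mul_pos_of_neg_of_neg (by linarith) hm'
    rw [← h4] at h5
    exact pos_of_mul_pos_right h5 h3.le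
  · intro t ht x hx h h1 h2 h3
    have hm' := hneg _ _ h
    have he := Real.exp_pos (k * x + -(l + 1) * t)
    rw [pdx_exp_mul hm] at h1
    rw [pdxx_exp_mul hm] at h2
    rw [pdt_exp_mul hm] at h3
    have h1' : k * m t x + pdx m t x = 0 := (mul_eq_zero.1 h1).resolve_left he.ne'
    have h2' := nonneg_of_mul_nonneg_right h2 he
    have h3' := nonpos_of_mul_nonpos_right h3 he
    have h4 := (abs_le.1 (hl (t, x) ⟨ht, Ioo_subset_Icc_self hx⟩)).2
    simp only at h4
    have h5 : pdx m t x = -(k * m t x) := by linarith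
    have h6 : k^2 * m t x ≤ pdxx m t x := by
      rw [h5] at h2'; linarith
    have h7 := hfp t ht x (Ioo_subset_Icc_self hx)
    rw [h5] at h7
    have h8 : 0 ≤ σ^2/2 * (pdxx m t x - k^2 * m t x) := by
      have : 0 ≤ pdxx m t x - k^2 * m t x := by linarith
      positivity
    have h9 : 0 < (l + 1 - (σ^2/2 * k^2 - 1/2 * pdxx u t x - k * (1/2 * (f t - pdx u t x))))
      * -m t x := mul_pos (by linarith) (by linarith)
    linarith

/-- The facts about a solution that the a priori estimates use: the two equations hold up to the
boundary, with a continuous price intercept `f`, and the density is nonnegative. -/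
structure IsRegularMFG (T L σ r ε : ℝ) (u m : ℝ → ℝ → ℝ) (f : ℝ → ℝ) : Prop where
  u_smooth : ContDiff ℝ (⊤ : ℕ∞) (uncurry u)
  m_smooth : ContDiff ℝ (⊤ : ℕ∞) (uncurry m)
  hjb : ∀ t ∈ Icc 0 T, ∀ x ∈ Icc 0 L,
    pdt u t x + σ^2/2 * pdxx u t x - r * u t x + 1/4 * (f t - pdx u t x)^2 = 0
  fp : ∀ t ∈ Icc 0 T, ∀ x ∈ Icc 0 L, pdt m t x - σ^2/2 * pdxx m t x
    + 1/2 * pdxx u t x * m t x - 1/2 * (f t - pdx u t x) * pdx m t x = 0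
  m_nonneg : ∀ t ∈ Icc 0 T, ∀ x ∈ Icc 0 L, 0 ≤ m t x
  u_bdry : ∀ t ∈ Icc 0 T, u t 0 = 0
  m_bdry : ∀ t ∈ Icc 0 T, m t 0 = 0
  ux_bdry : ∀ t ∈ Icc 0 T, pdx u t L = 0
  m_flux : ∀ t ∈ Icc 0 T, σ^2/2 * pdx m t L + 1/2 * f t * m t L = 0
  f_eq : ∀ t ∈ Icc 0 T, (2 + ε * mfgEta L m t) * f t =
    2 + ε * ∫ x in (0:ℝ)..L, pdx u t x * m t x

namespace IsMFGSolution

variable {T L σ r ε : ℝ} {uT m0 : ℝ → ℝ} {u m : ℝ → ℝ → ℝ}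

theorem continuous_eta (h : IsMFGSolution T L σ r ε uT m0 u m) : Continuous (mfgEta L m) :=
  continuous_integral h.m_smooth.continuous L

theorem continuousOn_mfgF (h : IsMFGSolution T L σ r ε uT m0 u m) {s : Set ℝ}
    (hs : ∀ t ∈ s, 2 + ε * mfgEta L m t ≠ 0) : ContinuousOn (mfgF L ε u m) s := by
  have h1 : ContinuousOn (fun t => 2 + ε * mfgEta L m t) s :=
    (continuous_const.add (continuous_const.mul h.continuous_eta)).continuousOn
  have h2 : Continuous fun t => ∫ x in (0:ℝ)..L, pdx u t x * m t x :=
    continuous_integral (g := fun t x => pdx u t x * m t x)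
      ((contDiff_pdx h.u_smooth).continuous.mul h.m_smooth.continuous) L
  exact (continuousOn_const.div h1 hs).add ((continuousOn_const.div h1 hs).mul h2.continuousOn)

theorem hjb_closed (h : IsMFGSolution T L σ r ε uT m0 u m) (hL : 0 < L) {s : ℝ} (hs : 0 < s)
    (hsT : s ≤ T) (hη : ∀ t ∈ Icc 0 s, 2 + ε * mfgEta L m t ≠ 0) :
    ∀ t ∈ Icc 0 s, ∀ x ∈ Icc 0 L, pdt u t x + σ^2/2 * pdxx u t x - r * u t x
      + 1/4 * (mfgF L ε u m t - pdx u t x)^2 = 0 := by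
  have hf : ContinuousOn (fun p : ℝ × ℝ => mfgF L ε u m p.1) (Icc 0 s ×ˢ Icc 0 L) :=
    (h.continuousOn_mfgF hη).comp continuousOn_fst fun p hp => hp.1
  have hu := h.u_smooth.continuous.continuousOn (s := Icc 0 s ×ˢ Icc 0 L)
  have hux := (contDiff_pdx h.u_smooth).continuous.continuousOn (s := Icc 0 s ×ˢ Icc 0 L)
  have huxx := (contDiff_pdxx h.u_smooth).continuous.continuousOn (s := Icc 0 s ×ˢ Icc 0 L)
  have hut := (contDiff_pdt h.u_smooth).continuous.continuousOn (s := Icc 0 s ×ˢ Icc 0 L)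
  refine eq_zero_on_closed_box hs hL
    (((hut.add (continuousOn_const.mul huxx)).sub (continuousOn_const.mul hu)).add
      (continuousOn_const.mul ((hf.sub hux).pow 2))) fun t ht x hx => ?_
  have := h.hjb t ⟨ht.1, ht.2.trans_le hsT⟩ x hx
  simp only [mfgH, mfgG] at this
  linarith

theorem fp_closed (h : IsMFGSolution T L σ r ε uT m0 u m) (hL : 0 < L) {s : ℝ} (hs : 0 < s)
    (hsT : s ≤ T) (hη : ∀ t ∈ Icc 0 s, 2 + ε * mfgEta L m t ≠ 0) :
    ∀ t ∈ Icc 0 s, ∀ x ∈ Icc 0 L, pdt m t x - σ^2/2 * pdxx m t x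
      + 1/2 * pdxx u t x * m t x - 1/2 * (mfgF L ε u m t - pdx u t x) * pdx m t x = 0 := by
  have hf : ContinuousOn (fun p : ℝ × ℝ => mfgF L ε u m p.1) (Icc 0 s ×ˢ Icc 0 L) :=
    (h.continuousOn_mfgF hη).comp continuousOn_fst fun p hp => hp.1
  have hm := h.m_smooth.continuous.continuousOn (s := Icc 0 s ×ˢ Icc 0 L)
  have hmx := (contDiff_pdx h.m_smooth).continuous.continuousOn (s := Icc 0 s ×ˢ Icc 0 L)
  have hmxx := (contDiff_pdxx h.m_smooth).continuous.continuousOn (s := Icc 0 s ×ˢ Icc 0 L)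
  have hmt := (contDiff_pdt h.m_smooth).continuous.continuousOn (s := Icc 0 s ×ˢ Icc 0 L)
  have hux := (contDiff_pdx h.u_smooth).continuous.continuousOn (s := Icc 0 s ×ˢ Icc 0 L)
  have huxx := (contDiff_pdxx h.u_smooth).continuous.continuousOn (s := Icc 0 s ×ˢ Icc 0 L)
  refine eq_zero_on_closed_box hs hL
    (((hmt.sub (continuousOn_const.mul hmxx)).add ((continuousOn_const.mul huxx).mul hm)).sub
      ((continuousOn_const.mul (hf.sub hux)).mul hmx)) fun t ht x hx => ?_
  have h1 := h.fp t ⟨ht.1, ht.2.trans_le hsT⟩ x hx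
  have h2 : HasDerivAt (fun y => mfgG L ε u m t y * m t y)
      (1/2 * (-pdxx u t x) * m t x + mfgG L ε u m t x * pdx m t x) x :=
    (((hasDerivAt_pdxx h.u_smooth t x).const_sub (mfgF L ε u m t)).const_mul (1/2)).mul
      (hasDerivAt_pdx h.m_smooth t x)
  rw [h2.deriv] at h1
  simp only [mfgG] at h1
  linarith

theorem nonneg_of_eta_ne (h : IsMFGSolution T L σ r ε uT m0 u m)
    (hd : MFGData T L σ r ε uT m0) {s : ℝ} (hs : 0 < s)
    (hsT : s ≤ T) (hη : ∀ t ∈ Icc 0 s, 2 + ε * mfgEta L m t ≠ 0) :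
    ∀ t ∈ Icc 0 s, ∀ x ∈ Icc 0 L, 0 ≤ m t x := by
  have hmem : ∀ t ∈ Icc 0 s, t ∈ Icc 0 T := fun t ht => ⟨ht.1, ht.2.trans hsT⟩
  refine density_nonneg hs hd.hL hd.hσ h.u_smooth h.m_smooth (h.continuousOn_mfgF hη)
    (h.fp_closed hd.hL hs hsT hη) (fun x hx => ?_) (fun t ht => h.m_bdry t (hmem t ht))
    (fun t ht => h.m_flux t (hmem t ht))
  rw [h.m_init x hx]
  exact hd.m0_nonneg x hx

theorem eta_zero (h : IsMFGSolution T L σ r ε uT m0 u m) (hd : MFGData T L σ r ε uT m0) :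
    mfgEta L m 0 = 1 := by
  rw [← hd.m0_mass]
  refine intervalIntegral.integral_congr fun x hx => h.m_init x ?_
  rwa [uIcc_of_le hd.hL.le] at hx

theorem eta_denominator_gt (h : IsMFGSolution T L σ r ε uT m0 u m)
    (hd : MFGData T L σ r ε uT m0) : ∀ t ∈ Icc 0 T, 1 < 2 + ε * mfgEta L m t := by
  by_contra! hcon
  set S : Set ℝ := Icc 0 T ∩ {t | 2 + ε * mfgEta L m t ≤ 1} with hS
  have hcl : IsClosed {t | 2 + ε * mfgEta L m t ≤ 1} :=
    isClosed_le (continuous_const.add (continuous_const.mul h.continuous_eta)) continuous_const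
  have hcomp : IsCompact S := isCompact_Icc.inter_right hcl
  obtain ⟨s, ⟨hsT, hs1⟩, hsmin⟩ := hcomp.exists_isLeast hcon
  have hs0 : 0 < s := by
    refine lt_of_le_of_ne hsT.1 fun h0 => ?_
    change 2 + ε * mfgEta L m s ≤ 1 at hs1
    rw [← h0, h.eta_zero hd] at hs1
    linarith [hd.hε]
  have hlt : ∀ t ∈ Icc 0 T, t < s → 1 < 2 + ε * mfgEta L m t := fun t ht hts => by
    by_contra! hle
    exact (hsmin ⟨ht, hle⟩).not_gt hts
  have hge : 1 ≤ 2 + ε * mfgEta L m s := by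
    have hcont : Continuous fun t => 2 + ε * mfgEta L m t :=
      continuous_const.add (continuous_const.mul h.continuous_eta)
    refine ge_of_tendsto (x := nhdsWithin s (Iio s))
      (hcont.continuousAt.tendsto.mono_left nhdsWithin_le_nhds) ?_
    filter_upwards [Ioo_mem_nhdsLT hs0] with t ht
    exact (hlt t ⟨ht.1.le, ht.2.le.trans hsT.2⟩ ht.2).le
  have hne : ∀ t ∈ Icc 0 s, 2 + ε * mfgEta L m t ≠ 0 := fun t ht => by
    rcases ht.2.lt_or_eq with hts | rfl
    · exact (one_pos.trans (hlt t ⟨ht.1, ht.2.trans hsT.2⟩ hts)).ne'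
    · exact (one_pos.trans_le hge).ne'
  have hnn := h.nonneg_of_eta_ne hd hs0 hsT.2 hne s (right_mem_Icc.2 hs0.le)
  have hη : 0 ≤ mfgEta L m s := intervalIntegral.integral_nonneg hd.hL.le hnn
  have := mul_nonneg hd.hε hη
  change 2 + ε * mfgEta L m s ≤ 1 at hs1
  linarith

theorem isRegular (h : IsMFGSolution T L σ r ε uT m0 u m) (hd : MFGData T L σ r ε uT m0) :
    IsRegularMFG T L σ r ε u m (mfgF L ε u m) := by
  have hne : ∀ t ∈ Icc 0 T, 2 + ε * mfgEta L m t ≠ 0 := fun t ht =>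
    (one_pos.trans (h.eta_denominator_gt hd t ht)).ne'
  exact
    { u_smooth := h.u_smooth
      m_smooth := h.m_smooth
      hjb := h.hjb_closed hd.hL hd.hT le_rfl hne
      fp := h.fp_closed hd.hL hd.hT le_rfl hne
      m_nonneg := h.nonneg_of_eta_ne hd hd.hT le_rfl hne
      u_bdry := h.u_bdry
      m_bdry := h.m_bdry
      ux_bdry := h.ux_bdry
      m_flux := fun t ht => by
        have := h.m_flux t ht
        rw [mfgG, h.ux_bdry t ht] at this
        linarith
      f_eq := fun t ht => by
        have := hne t ht
        simp only [mfgF]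
        field_simp }

end IsMFGSolution

theorem antitoneOn_of_hasDerivAt_nonpos {g g' : ℝ → ℝ} {a b : ℝ}
    (hg : ∀ t ∈ Icc a b, HasDerivAt g (g' t) t) (hle : ∀ t ∈ Icc a b, g' t ≤ 0) :
    AntitoneOn g (Icc a b) := by
  refine antitoneOn_of_deriv_nonpos (convex_Icc a b)
    (fun t ht => (hg t ht).continuousAt.continuousWithinAt)
    (fun t ht => (hg t (interior_subset ht)).differentiableAt.differentiableWithinAt)
    fun t ht => ?_
  rw [(hg t (interior_subset ht)).deriv]
  exact hle t (interior_subset ht)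

theorem monotoneOn_of_hasDerivAt_nonneg {g g' : ℝ → ℝ} {a b : ℝ}
    (hg : ∀ t ∈ Icc a b, HasDerivAt g (g' t) t) (hle : ∀ t ∈ Icc a b, 0 ≤ g' t) :
    MonotoneOn g (Icc a b) := by
  refine monotoneOn_of_deriv_nonneg (convex_Icc a b)
    (fun t ht => (hg t ht).continuousAt.continuousWithinAt)
    (fun t ht => (hg t (interior_subset ht)).differentiableAt.differentiableWithinAt)
    fun t ht => ?_
  rw [(hg t (interior_subset ht)).deriv]
  exact hle t (interior_subset ht)

/-- The expected marginal value `∫₀^L u_x m dx`. -/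
noncomputable def meanSlope (L : ℝ) (u m : ℝ → ℝ → ℝ) (t : ℝ) : ℝ :=
  ∫ x in (0:ℝ)..L, pdx u t x * m t x

/-- The expected squared marginal value `∫₀^L u_x² m dx`. -/
noncomputable def meanSqSlope (L : ℝ) (u m : ℝ → ℝ → ℝ) (t : ℝ) : ℝ :=
  ∫ x in (0:ℝ)..L, pdx u t x ^ 2 * m t x

/-- The expected value `∫₀^L u m dx`. -/
noncomputable def meanValue (L : ℝ) (u m : ℝ → ℝ → ℝ) (t : ℝ) : ℝ :=
  ∫ x in (0:ℝ)..L, u t x * m t x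

/-- A superlinear convex function vanishing to second order at `0`, with derivative
`log (1 + s ^ 2) / 2`. -/
noncomputable def entropyDensity (s : ℝ) : ℝ :=
  1/2 * s * Real.log (1 + s^2) - s + Real.arctan s

/-- The entropy `∫₀^L entropyDensity m dx`. -/
noncomputable def entropy (L : ℝ) (m : ℝ → ℝ → ℝ) (t : ℝ) : ℝ :=
  ∫ x in (0:ℝ)..L, entropyDensity (m t x)

theorem hasDerivAt_half_log_one_add_sq (s : ℝ) :
    HasDerivAt (fun s => 1/2 * Real.log (1 + s^2)) (s / (1 + s^2)) s := by
  have hpos : 0 < 1 + s^2 := by positivity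
  have h1 : HasDerivAt (fun s : ℝ => 1 + s^2) (2 * s) s := by
    simpa using (hasDerivAt_pow 2 s).const_add 1
  refine ((h1.log hpos.ne').const_mul (1/2)).congr_deriv ?_
  field_simp

theorem hasDerivAt_entropyDensity (s : ℝ) :
    HasDerivAt entropyDensity (1/2 * Real.log (1 + s^2)) s := by
  have hpos : 0 < 1 + s^2 := by positivity
  have h1 := (((hasDerivAt_id s).mul (hasDerivAt_half_log_one_add_sq s)).sub (hasDerivAt_id s)).add
    (Real.hasDerivAt_arctan s)
  have h2 : entropyDensity = ((id * fun s => 1/2 * Real.log (1 + s^2)) - id) + Real.arctan := by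
    ext s
    simp [entropyDensity]
    ring
  rw [h2]
  refine h1.congr_deriv ?_
  simp only [id]
  field_simp
  ring

theorem contDiff_entropyDensity : ContDiff ℝ (⊤ : ℕ∞) entropyDensity := by
  have h1 : ContDiff ℝ (⊤ : ℕ∞) fun s : ℝ => Real.log (1 + s^2) :=
    (contDiff_const.add (contDiff_id.pow 2)).log fun s => by positivity
  exact (((contDiff_const.mul contDiff_id).mul h1).sub contDiff_id).add Real.contDiff_arctan

namespace IsRegularMFG

variable {T L σ r ε : ℝ} {u m : ℝ → ℝ → ℝ} {f : ℝ → ℝ}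

theorem u_nonneg (h : IsRegularMFG T L σ r ε u m f) (hT : 0 < T) (hL : 0 < L) (hσ : 0 < σ)
    (hr : 0 < r) (hterm : ∀ x ∈ Icc 0 L, 0 ≤ u T x) :
    ∀ t ∈ Icc 0 T, ∀ x ∈ Icc 0 L, 0 ≤ u t x := by
  obtain ⟨k, hk0, hk⟩ : ∃ k : ℝ, k < 0 ∧ σ^2 * k^2 = r := by
    refine ⟨-(√r / σ), neg_neg_of_pos (by positivity), ?_⟩
    rw [neg_sq, div_pow, Real.sq_sqrt hr.le]
    field_simp
  have hneg : ∀ t x, Real.exp (k * x + 0 * t) * u t x < 0 → u t x < 0 := fun t x h => by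
    by_contra! h'
    exact (mul_nonneg (Real.exp_pos _).le h').not_gt h
  have key := backward_min_principle hT hL (contDiff_exp_mul h.u_smooth k 0)
    (fun x hx => mul_nonneg (Real.exp_pos _).le (hterm x hx))
    (fun t ht => by simp [h.u_bdry t ht]) ?_ ?_
  · intro t ht x hx
    exact nonneg_of_mul_nonneg_right (key t ht x hx) (Real.exp_pos _)
  · intro t ht hlt
    rw [pdx_exp_mul h.u_smooth, h.ux_bdry t ht, add_zero]
    exact mul_pos (Real.exp_pos _) (mul_pos_of_neg_of_neg hk0 (hneg _ _ hlt))
  · intro t ht x hx hlt h1 h2 h3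
    have hu := hneg _ _ hlt
    have he := Real.exp_pos (k * x + 0 * t)
    rw [pdx_exp_mul h.u_smooth] at h1
    rw [pdxx_exp_mul h.u_smooth] at h2
    rw [pdt_exp_mul h.u_smooth] at h3
    have h1' := (mul_eq_zero.1 h1).resolve_left he.ne'
    have h2' := nonneg_of_mul_nonneg_right h2 he
    have h3' := nonneg_of_mul_nonneg_right h3 he
    have h4 : pdx u t x = -(k * u t x) := by linarith
    have h5 : 0 ≤ σ^2 * (pdxx u t x - k^2 * u t x) := by
      have : 0 ≤ pdxx u t x - k^2 * u t x := by
        rw [h4] at h2'; linarith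
      positivity
    have h6 := h.hjb t ht x (Ioo_subset_Icc_self hx)
    have h7 : σ^2 * (k^2 * u t x) = r * u t x := by rw [← hk]; ring
    have h8 : r * u t x < 0 := mul_neg_of_pos_of_neg hr hu
    linarith [sq_nonneg (f t - pdx u t x)]

theorem ux_zero_nonneg (h : IsRegularMFG T L σ r ε u m f) (hL : 0 < L)
    (hu : ∀ t ∈ Icc 0 T, ∀ x ∈ Icc 0 L, 0 ≤ u t x) : ∀ t ∈ Icc 0 T, 0 ≤ pdx u t 0 :=
  fun t ht => nonneg_deriv_of_left_min hL (hasDerivAt_pdx h.u_smooth t 0) fun x hx => by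
    rw [h.u_bdry t ht]
    exact hu t ht x hx

/-- The space derivative of the Hamilton-Jacobi equation. -/
theorem ux_eq (h : IsRegularMFG T L σ r ε u m f) :
    ∀ t ∈ Icc 0 T, ∀ x ∈ Ioo 0 L, pdt (pdx u) t x + σ^2/2 * pdxx (pdx u) t x - r * pdx u t x
      - 1/2 * (f t - pdx u t x) * pdx (pdx u) t x = 0 := by
  intro t ht x hx
  have h1 : (fun y => pdt u t y + σ^2/2 * pdxx u t y - r * u t y + 1/4 * (f t - pdx u t y)^2)
      =ᶠ[nhds x] fun _ => 0 := by
    filter_upwards [Icc_mem_nhds hx.1 hx.2] with y hy using h.hjb t ht y hy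
  have h2 := ((((hasDerivAt_pdx (contDiff_pdt h.u_smooth) t x).add
    ((hasDerivAt_pdx (contDiff_pdxx h.u_smooth) t x).const_mul (σ^2/2))).sub
    ((hasDerivAt_pdx h.u_smooth t x).const_mul r)).add
    ((((hasDerivAt_pdxx h.u_smooth t x).const_sub (f t)).pow 2).const_mul (1/4)))
  have h3 := h2.unique ((hasDerivAt_const x (0:ℝ)).congr_of_eventuallyEq h1)
  rw [pdx_pdt_comm h.u_smooth] at h3
  have h4 : pdx (pdxx u) t x = pdxx (pdx u) t x := rfl
  rw [h4] at h3
  rw [← h3, pdxx_eq_pdx_pdx u]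
  push_cast
  ring

theorem ux_nonneg (h : IsRegularMFG T L σ r ε u m f) (hT : 0 < T) (hL : 0 < L) (hr : 0 < r)
    (hu : ∀ t ∈ Icc 0 T, ∀ x ∈ Icc 0 L, 0 ≤ u t x) (hterm : ∀ x ∈ Icc 0 L, 0 ≤ pdx u T x) :
    ∀ t ∈ Icc 0 T, ∀ x ∈ Icc 0 L, 0 ≤ pdx u t x := by
  refine backward_min_principle hT hL (contDiff_pdx h.u_smooth) hterm
    (h.ux_zero_nonneg hL hu) (fun t ht hlt => absurd (h.ux_bdry t ht) hlt.ne) ?_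
  intro t ht x hx hlt h1 h2 h3
  have h4 := h.ux_eq t ht x hx
  rw [h1] at h4
  have h5 : 0 ≤ σ^2/2 * pdxx (pdx u) t x := by positivity
  linarith [mul_neg_of_pos_of_neg hr hlt]

/-- A bound for `u_x` on the parabolic boundary is a bound on the whole box. -/
theorem ux_le (h : IsRegularMFG T L σ r ε u m f) (hT : 0 < T) (hL : 0 < L) (hr : 0 < r) {K : ℝ}
    (hK : 0 ≤ K) (hterm : ∀ x ∈ Icc 0 L, pdx u T x ≤ K) (hzero : ∀ t ∈ Icc 0 T, pdx u t 0 ≤ K) :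
    ∀ t ∈ Icc 0 T, ∀ x ∈ Icc 0 L, pdx u t x ≤ K := by
  set w : ℝ → ℝ → ℝ := fun t x => K - pdx u t x with hwdef
  have hw : ContDiff ℝ (⊤ : ℕ∞) (uncurry w) := contDiff_const.sub (contDiff_pdx h.u_smooth)
  have hwx : ∀ t x, pdx w t x = -pdx (pdx u) t x := fun t x =>
    ((hasDerivAt_pdx (contDiff_pdx h.u_smooth) t x).const_sub K).deriv
  have hwxx : ∀ t x, pdxx w t x = -pdxx (pdx u) t x := fun t x => by
    have h1 : pdx w t = fun x => -pdx (pdx u) t x := funext (hwx t)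
    change deriv (pdx w t) x = _
    rw [h1]
    exact (hasDerivAt_pdxx (contDiff_pdx h.u_smooth) t x).neg.deriv
  have hwt : ∀ t x, pdt w t x = -pdt (pdx u) t x := fun t x =>
    ((hasDerivAt_pdt (contDiff_pdx h.u_smooth) t x).const_sub K).deriv
  have key := backward_min_principle hT hL hw (fun x hx => sub_nonneg.2 (hterm x hx))
    (fun t ht => sub_nonneg.2 (hzero t ht)) ?_ ?_
  · exact fun t ht x hx => sub_nonneg.1 (key t ht x hx)
  · intro t ht hlt
    simp only [hwdef, h.ux_bdry t ht] at hlt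
    linarith
  · intro t ht x hx hlt h1 h2 h3
    rw [hwx, neg_eq_zero] at h1
    rw [hwxx] at h2
    rw [hwt] at h3
    have h4 := h.ux_eq t ht x hx
    rw [h1] at h4
    have h5 : 0 ≤ σ^2/2 * -pdxx (pdx u) t x := by positivity
    have h6 : 0 < r * pdx u t x := mul_pos hr (by simp only [hwdef] at hlt; linarith)
    linarith

/-- A logarithmic barrier bounds `u_x` at the left end point. -/
theorem ux_zero_le (h : IsRegularMFG T L σ r ε u m f) (hT : 0 < T) (hL : 0 < L) (hσ : 0 < σ)
    (hr : 0 < r) {U A F : ℝ} (hf0 : ∀ t ∈ Icc 0 T, 0 ≤ f t) (hf : ∀ t ∈ Icc 0 T, f t ≤ F)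
    (hF : 0 ≤ F) (hA : 0 ≤ A) (hU : ∀ t ∈ Icc 0 T, ∀ x ∈ Icc 0 L, u t x ≤ U)
    (hterm : ∀ x ∈ Icc 0 L, u T x ≤ A * x) :
    ∀ t ∈ Icc 0 T, pdx u t 0 ≤
      A * Real.exp (A * L / (2 * σ^2)) + (1/2 * F + 1) * Real.exp (U / (2 * σ^2)) := by
  set K := A * Real.exp (A * L / (2 * σ^2)) + (1/2 * F + 1) * Real.exp (U / (2 * σ^2)) with hK
  set c := 1 / (2 * σ^2) with hc
  have hc0 : 0 < c := by positivity
  have hcσ : σ^2 * c = 1/2 := by rw [hc]; field_simp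
  set w : ℝ → ℝ → ℝ := fun t x => 1 + K * c * x - Real.exp (c * u t x) with hwdef
  have hKA : A * Real.exp (A * L * c) ≤ K := by
    have : 0 ≤ (1/2 * F + 1) * Real.exp (U / (2 * σ^2)) := by positivity
    rw [hK, hc, mul_one_div]
    linarith
  have hKF : (1/2 * F + 1) * Real.exp (c * U) ≤ K := by
    have : 0 ≤ A * Real.exp (A * L / (2 * σ^2)) := by positivity
    rw [hK, hc, mul_comm _ U, mul_one_div]
    linarith
  have hK0 : 0 < K := lt_of_lt_of_le (by positivity) hKF
  have hu := h.u_smooth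
  have hw : ContDiff ℝ (⊤ : ℕ∞) (uncurry w) :=
    (contDiff_const.add (contDiff_const.mul contDiff_snd)).sub
      (Real.contDiff_exp.comp (contDiff_const.mul hu))
  have hwx : ∀ t x, HasDerivAt (w t) (K * c - Real.exp (c * u t x) * (c * pdx u t x)) x :=
    fun t x => ((((hasDerivAt_id x).const_mul (K * c)).const_add 1).sub
      (((hasDerivAt_pdx hu t x).const_mul c).exp)).congr_deriv (by ring)
  have hwxx : ∀ t x, pdxx w t x =
      -(Real.exp (c * u t x) * (c * (pdxx u t x + c * pdx u t x ^ 2))) := fun t x => by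
    have h1 : pdx w t = fun x => K * c - Real.exp (c * u t x) * (c * pdx u t x) :=
      funext fun x => (hwx t x).deriv
    change deriv (pdx w t) x = _
    rw [h1]
    exact (((((hasDerivAt_pdx hu t x).const_mul c).exp.mul
      ((hasDerivAt_pdxx hu t x).const_mul c)).const_sub (K * c)).congr_deriv (by ring)).deriv
  have hwt : ∀ t x, pdt w t x = -(Real.exp (c * u t x) * (c * pdt u t x)) := fun t x =>
    (((hasDerivAt_pdt hu t x).const_mul c).exp.const_sub (1 + K * c * x)).deriv
  have key := backward_min_principle hT hL hw ?_ ?_ ?_ ?_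
  · intro t ht
    have hd := nonneg_deriv_of_left_min hL (hwx t 0) fun x hx => by
      simpa [hwdef, h.u_bdry t ht] using key t ht x hx
    rw [h.u_bdry t ht, mul_zero, Real.exp_zero, one_mul, mul_comm K c, ← mul_sub] at hd
    linarith [nonneg_of_mul_nonneg_right hd hc0]
  · intro x hx
    have h1 : Real.exp (c * u T x) ≤ Real.exp (c * (A * x)) :=
      Real.exp_le_exp.2 (mul_le_mul_of_nonneg_left (hterm x hx) hc0.le)
    have h2 := Real.add_one_le_exp (-(c * (A * x)))
    have h3 : Real.exp (c * (A * x)) ≤ 1 + c * (A * x) * Real.exp (c * (A * x)) := by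
      have h4 := mul_le_mul_of_nonneg_right h2 (Real.exp_pos (c * (A * x))).le
      rw [← Real.exp_add, neg_add_cancel, Real.exp_zero] at h4
      linarith
    have h5 : Real.exp (c * (A * x)) ≤ Real.exp (A * L * c) := by
      refine Real.exp_le_exp.2 ?_
      have := mul_le_mul_of_nonneg_left hx.2 (mul_nonneg hc0.le hA)
      linarith
    have hx0 : 0 ≤ c * x := mul_nonneg hc0.le hx.1
    have h6 : A * Real.exp (c * (A * x)) ≤ K :=
      (mul_le_mul_of_nonneg_left h5 hA).trans hKA
    have h7 := mul_le_mul_of_nonneg_left h6 hx0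
    simp only [hwdef]
    linarith
  · intro t ht
    simp [hwdef, h.u_bdry t ht]
  · intro t ht _
    have h1 : pdx w t L = _ := (hwx t L).deriv
    rw [h1, h.ux_bdry t ht]
    simp only [mul_zero, sub_zero]
    positivity
  · intro t ht x hx hlt h1 h2 h3
    have he := Real.exp_pos (c * u t x)
    have h1' : K * c - Real.exp (c * u t x) * (c * pdx u t x) = 0 := (hwx t x).deriv.symm.trans h1
    have hpK : Real.exp (c * u t x) * pdx u t x = K := by
      refine mul_left_cancel₀ hc0.ne' ?_
      linarith
    rw [hwxx] at h2
    rw [hwt] at h3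
    have h2' : pdxx u t x + c * pdx u t x ^ 2 ≤ 0 := by
      by_contra! h4
      have : 0 < Real.exp (c * u t x) * (c * (pdxx u t x + c * pdx u t x ^ 2)) := by positivity
      linarith
    have h3' : pdt u t x ≤ 0 := by
      by_contra! h4
      have : 0 < Real.exp (c * u t x) * (c * pdt u t x) := by positivity
      linarith
    have hupos : 0 < u t x := by
      by_contra! h4
      have h5 : Real.exp (c * u t x) ≤ 1 :=
        Real.exp_le_one_iff.2 (mul_nonpos_of_nonneg_of_nonpos hc0.le h4)
      have h6 : 0 ≤ K * c * x := by have := hx.1; positivity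
      simp only [hwdef] at hlt
      linarith
    have hxI := Ioo_subset_Icc_self hx
    have hp : 1/2 * F + 1 ≤ pdx u t x := by
      have h4 : Real.exp (c * u t x) ≤ Real.exp (c * U) :=
        Real.exp_le_exp.2 (mul_le_mul_of_nonneg_left (hU t ht x hxI) hc0.le)
      have h5 : (1/2 * F + 1) * Real.exp (c * u t x) ≤ pdx u t x * Real.exp (c * u t x) := by
        rw [mul_comm (pdx u t x), hpK]
        exact (mul_le_mul_of_nonneg_left h4 (by positivity)).trans hKF
      exact le_of_mul_le_mul_right h5 he
    have h4 := h.hjb t ht x hxI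
    have h5 : σ^2/2 * (pdxx u t x + c * pdx u t x ^ 2) ≤ 0 :=
      mul_nonpos_of_nonneg_of_nonpos (by positivity) h2'
    have h6 : σ^2/2 * (c * pdx u t x ^ 2) = 1/4 * pdx u t x ^ 2 := by
      linear_combination (1/2) * pdx u t x ^ 2 * hcσ
    have h7 : f t * (1/2 * f t - pdx u t x) ≤ 0 :=
      mul_nonpos_of_nonneg_of_nonpos (hf0 t ht) (by linarith [hf t ht])
    have h8 := mul_pos hr hupos
    linarith

end IsRegularMFG

namespace IsRegularMFG

variable {T L σ r ε : ℝ} {u m : ℝ → ℝ → ℝ} {f : ℝ → ℝ}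

theorem hasDerivAt_flux (h : IsRegularMFG T L σ r ε u m f) {t x : ℝ} (ht : t ∈ Icc 0 T)
    (hx : x ∈ Icc 0 L) :
    HasDerivAt (fun y => σ^2/2 * pdx m t y + 1/2 * (f t - pdx u t y) * m t y) (pdt m t x) x := by
  have h1 := ((hasDerivAt_pdxx h.m_smooth t x).const_mul (σ^2/2)).add
    ((((hasDerivAt_pdxx h.u_smooth t x).const_sub (f t)).const_mul (1/2)).mul
      (hasDerivAt_pdx h.m_smooth t x))
  refine h1.congr_deriv ?_
  linarith [h.fp t ht x hx]

theorem flux_right (h : IsRegularMFG T L σ r ε u m f) {t : ℝ} (ht : t ∈ Icc 0 T) :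
    σ^2/2 * pdx m t L + 1/2 * (f t - pdx u t L) * m t L = 0 := by
  rw [h.ux_bdry t ht, sub_zero]
  exact h.m_flux t ht

theorem hasDerivAt_eta (h : IsRegularMFG T L σ r ε u m f) (hL : 0 < L) {t : ℝ}
    (ht : t ∈ Icc 0 T) : HasDerivAt (mfgEta L m) (-(σ^2/2 * pdx m t 0)) t := by
  refine (hasDerivAt_integral h.m_smooth L t).congr_deriv ?_
  rw [intervalIntegral.integral_eq_sub_of_hasDerivAt
    (f := fun y => σ^2/2 * pdx m t y + 1/2 * (f t - pdx u t y) * m t y)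
    (fun x hx => h.hasDerivAt_flux ht (by rwa [uIcc_of_le hL.le] at hx))
    ((continuous_space (contDiff_pdt h.m_smooth) t).intervalIntegrable _ _), h.flux_right ht,
    h.m_bdry t ht]
  ring

theorem eta_nonneg (h : IsRegularMFG T L σ r ε u m f) (hL : 0 < L) {t : ℝ} (ht : t ∈ Icc 0 T) :
    0 ≤ mfgEta L m t :=
  intervalIntegral.integral_nonneg hL.le (h.m_nonneg t ht)

theorem eta_le (h : IsRegularMFG T L σ r ε u m f) (hL : 0 < L) {t : ℝ} (ht : t ∈ Icc 0 T) :
    mfgEta L m t ≤ mfgEta L m 0 := by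
  refine antitoneOn_of_hasDerivAt_nonpos (fun s hs => h.hasDerivAt_eta hL hs) (fun s hs => ?_)
    (left_mem_Icc.2 (ht.1.trans ht.2)) ht ht.1
  have h1 : 0 ≤ pdx m s 0 := nonneg_deriv_of_left_min hL (hasDerivAt_pdx h.m_smooth s 0)
    fun x hx => by
      rw [h.m_bdry s hs]
      exact h.m_nonneg s hs x hx
  have : 0 ≤ σ^2/2 * pdx m s 0 := by positivity
  linarith

/-- The energy identity. -/
theorem hasDerivAt_meanValue (h : IsRegularMFG T L σ r ε u m f) (hL : 0 < L) {t : ℝ}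
    (ht : t ∈ Icc 0 T) :
    HasDerivAt (meanValue L u m)
      (r * meanValue L u m t - 1/4 * f t ^ 2 * mfgEta L m t + 1/4 * meanSqSlope L u m t) t := by
  have hum : ContDiff ℝ (⊤ : ℕ∞) (uncurry fun t x => u t x * m t x) := h.u_smooth.mul h.m_smooth
  have hu := continuous_space h.u_smooth t
  have hm := continuous_space h.m_smooth t
  have hux := continuous_space (contDiff_pdx h.u_smooth) t
  have hmx := continuous_space (contDiff_pdx h.m_smooth) t
  have huxx := continuous_space (contDiff_pdxx h.u_smooth) t
  have hmt := continuous_space (contDiff_pdt h.m_smooth) t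
  refine (hasDerivAt_integral hum L t).congr_deriv ?_
  set J : ℝ → ℝ := fun y => u t y * (σ^2/2 * pdx m t y + 1/2 * (f t - pdx u t y) * m t y)
    - σ^2/2 * (pdx u t y * m t y) with hJ
  set J' : ℝ → ℝ := fun y => pdx u t y * (σ^2/2 * pdx m t y + 1/2 * (f t - pdx u t y) * m t y)
    + u t y * pdt m t y - σ^2/2 * (pdxx u t y * m t y + pdx u t y * pdx m t y) with hJ'
  have hJ'c : Continuous J' := by fun_prop
  have hJint : ∫ x in (0:ℝ)..L, J' x = 0 := by
    rw [intervalIntegral.integral_eq_sub_of_hasDerivAt (f := J) (fun x hx => ?_)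
      (hJ'c.intervalIntegrable _ _)]
    · simp only [hJ]
      rw [h.flux_right ht, h.u_bdry t ht, h.m_bdry t ht, h.ux_bdry t ht]
      ring
    · rw [uIcc_of_le hL.le] at hx
      exact ((hasDerivAt_pdx h.u_smooth t x).mul (h.hasDerivAt_flux ht hx)).sub
        (((hasDerivAt_pdxx h.u_smooth t x).mul (hasDerivAt_pdx h.m_smooth t x)).const_mul _)
  have hcongr : ∫ x in (0:ℝ)..L, pdt (fun t x => u t x * m t x) t x =
      ∫ x in (0:ℝ)..L, (r * (u t x * m t x) - 1/4 * f t ^ 2 * m t x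
        + 1/4 * (pdx u t x ^ 2 * m t x) + J' x) := by
    refine intervalIntegral.integral_congr fun x hx => ?_
    rw [uIcc_of_le hL.le] at hx
    have h1 : pdt (fun t x => u t x * m t x) t x = pdt u t x * m t x + u t x * pdt m t x :=
      ((hasDerivAt_pdt h.u_smooth t x).mul (hasDerivAt_pdt h.m_smooth t x)).deriv
    simp only [h1, hJ']
    linear_combination m t x * h.hjb t ht x hx
  have i1 : IntervalIntegrable (fun x => r * (u t x * m t x)) volume 0 L :=
    Continuous.intervalIntegrable (by fun_prop) _ _
  have i2 : IntervalIntegrable (fun x => 1/4 * f t ^ 2 * m t x) volume 0 L :=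
    Continuous.intervalIntegrable (by fun_prop) _ _
  have i3 : IntervalIntegrable (fun x => 1/4 * (pdx u t x ^ 2 * m t x)) volume 0 L :=
    Continuous.intervalIntegrable (by fun_prop) _ _
  rw [hcongr, intervalIntegral.integral_add ((i1.sub i2).add i3) (hJ'c.intervalIntegrable _ _),
    intervalIntegral.integral_add (i1.sub i2) i3, intervalIntegral.integral_sub i1 i2, hJint,
    intervalIntegral.integral_const_mul, intervalIntegral.integral_const_mul,
    intervalIntegral.integral_const_mul, add_zero]
  rfl

/-- The entropy dissipation inequality. -/
theorem hasDerivAt_entropy (h : IsRegularMFG T L σ r ε u m f) (hL : 0 < L) (hσ : 0 < σ) {t : ℝ}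
    (ht : t ∈ Icc 0 T) :
    ∃ d, HasDerivAt (entropy L m) d t ∧
      d ≤ 1/(4 * σ^2) * (f t ^ 2 * mfgEta L m t + meanSqSlope L u m t) := by
  have hem : ContDiff ℝ (⊤ : ℕ∞) (uncurry fun t x => entropyDensity (m t x)) :=
    contDiff_entropyDensity.comp h.m_smooth
  have hm := continuous_space h.m_smooth t
  have hux := continuous_space (contDiff_pdx h.u_smooth) t
  have hmx := continuous_space (contDiff_pdx h.m_smooth) t
  have hmt := continuous_space (contDiff_pdt h.m_smooth) t
  refine ⟨_, hasDerivAt_integral hem L t, ?_⟩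
  have hpos : ∀ x, 0 < 1 + m t x ^ 2 := fun x => by positivity
  have hlog : Continuous fun x => Real.log (1 + m t x ^ 2) :=
    (continuous_const.add (hm.pow 2)).log fun x => (hpos x).ne'
  have hdiv : Continuous fun x => m t x / (1 + m t x ^ 2) :=
    hm.div (continuous_const.add (hm.pow 2)) fun x => (hpos x).ne'
  set J : ℝ → ℝ := fun y => 1/2 * Real.log (1 + m t y ^ 2) *
    (σ^2/2 * pdx m t y + 1/2 * (f t - pdx u t y) * m t y) with hJ
  set J' : ℝ → ℝ := fun y => m t y / (1 + m t y ^ 2) * pdx m t y *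
    (σ^2/2 * pdx m t y + 1/2 * (f t - pdx u t y) * m t y)
    + 1/2 * Real.log (1 + m t y ^ 2) * pdt m t y with hJ'
  have hJ'c : Continuous J' := by fun_prop
  have hJint : ∫ x in (0:ℝ)..L, J' x = 0 := by
    rw [intervalIntegral.integral_eq_sub_of_hasDerivAt (f := J) (fun x hx => ?_)
      (hJ'c.intervalIntegrable _ _)]
    · simp only [hJ]
      rw [h.flux_right ht, h.m_bdry t ht]
      simp
    · rw [uIcc_of_le hL.le] at hx
      exact ((hasDerivAt_half_log_one_add_sq (m t x)).comp x
        (hasDerivAt_pdx h.m_smooth t x)).mul (h.hasDerivAt_flux ht hx)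
  have i2 : IntervalIntegrable (fun x => f t ^ 2 * m t x) volume 0 L :=
    Continuous.intervalIntegrable (by fun_prop) _ _
  have i3 : IntervalIntegrable (fun x => pdx u t x ^ 2 * m t x) volume 0 L :=
    Continuous.intervalIntegrable (by fun_prop) _ _
  have hval : ∫ x in (0:ℝ)..L, (J' x + 1/(4 * σ^2) * (f t ^ 2 * m t x + pdx u t x ^ 2 * m t x))
      = 1/(4 * σ^2) * (f t ^ 2 * mfgEta L m t + meanSqSlope L u m t) := by
    rw [intervalIntegral.integral_add (hJ'c.intervalIntegrable _ _) ((i2.add i3).const_mul _),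
      hJint, intervalIntegral.integral_const_mul, intervalIntegral.integral_add i2 i3,
      intervalIntegral.integral_const_mul, zero_add]
    rfl
  rw [← hval]
  refine intervalIntegral.integral_mono_on hL.le
    ((continuous_space (contDiff_pdt hem) t).intervalIntegrable _ _)
    (Continuous.intervalIntegrable (by fun_prop) _ _) fun x hx => ?_
  have h1 : pdt (fun t x => entropyDensity (m t x)) t x =
      1/2 * Real.log (1 + m t x ^ 2) * pdt m t x :=
    (HasDerivAt.comp (h₂ := entropyDensity) t (hasDerivAt_entropyDensity (m t x))
      (hasDerivAt_pdt h.m_smooth t x)).deriv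
  rw [h1]
  simp only [hJ']
  set M := m t x with hM
  set a := pdx m t x with ha
  set p := pdx u t x with hp
  have hM0 : 0 ≤ M := h.m_nonneg t ht x hx
  have hq0 : 0 ≤ M / (1 + M ^ 2) := by positivity
  have hqM : M / (1 + M ^ 2) * M ^ 2 ≤ M := by
    rw [div_mul_eq_mul_div, div_le_iff₀ (by positivity)]
    nlinarith
  have h2 : 0 ≤ a * (σ^2/2 * a + 1/2 * (f t - p) * M) + 1/(8 * σ^2) * ((f t - p)^2 * M^2) := by
    have h3 : a * (σ^2/2 * a + 1/2 * (f t - p) * M) + 1/(8 * σ^2) * ((f t - p)^2 * M^2) =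
        1/(8 * σ^2) * (2 * σ^2 * a + (f t - p) * M)^2 := by
      field_simp
      ring
    rw [h3]
    positivity
  have h4 := mul_nonneg hq0 h2
  have h5 : M / (1 + M ^ 2) * (1/(8 * σ^2) * ((f t - p)^2 * M^2)) ≤
      1/(4 * σ^2) * (f t ^ 2 * M + p ^ 2 * M) := by
    have h6 : (f t - p)^2 * (M / (1 + M ^ 2) * M^2) ≤ 2 * (f t ^ 2 * M + p ^ 2 * M) := by
      have h7 := mul_le_mul_of_nonneg_left hqM (sq_nonneg (f t - p))
      have h8 := mul_nonneg (sq_nonneg (f t + p)) hM0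
      linarith
    have h9 := mul_le_mul_of_nonneg_left h6 (show (0:ℝ) ≤ 1/(8 * σ^2) by positivity)
    have h10 : 1/(8 * σ^2) * (2 * (f t ^ 2 * M + p ^ 2 * M)) =
        1/(4 * σ^2) * (f t ^ 2 * M + p ^ 2 * M) := by
      field_simp
      ring
    linarith
  linarith

theorem meanSlope_sq_le (h : IsRegularMFG T L σ r ε u m f) (hL : 0 < L) {t : ℝ}
    (ht : t ∈ Icc 0 T) :
    meanSlope L u m t ^ 2 ≤ mfgEta L m t * meanSqSlope L u m t := by
  have hm := continuous_space h.m_smooth t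
  have hux := continuous_space (contDiff_pdx h.u_smooth) t
  have key : ∀ s : ℝ, 0 ≤ mfgEta L m t * (s * s) + (-2 * meanSlope L u m t) * s
      + meanSqSlope L u m t := fun s => by
    have h1 : 0 ≤ ∫ x in (0:ℝ)..L, (s - pdx u t x)^2 * m t x :=
      intervalIntegral.integral_nonneg hL.le fun x hx =>
        mul_nonneg (sq_nonneg _) (h.m_nonneg t ht x hx)
    have i1 : IntervalIntegrable (fun x => s^2 * m t x) volume 0 L :=
      Continuous.intervalIntegrable (by fun_prop) _ _
    have i2 : IntervalIntegrable (fun x => 2 * s * (pdx u t x * m t x)) volume 0 L :=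
      Continuous.intervalIntegrable (by fun_prop) _ _
    have i3 : IntervalIntegrable (fun x => pdx u t x ^ 2 * m t x) volume 0 L :=
      Continuous.intervalIntegrable (by fun_prop) _ _
    have h2 : (fun x => (s - pdx u t x)^2 * m t x) = fun x =>
        s^2 * m t x - 2 * s * (pdx u t x * m t x) + pdx u t x ^ 2 * m t x := by
      ext x
      ring
    rw [h2, intervalIntegral.integral_add (i1.sub i2) i3, intervalIntegral.integral_sub i1 i2,
      intervalIntegral.integral_const_mul, intervalIntegral.integral_const_mul] at h1
    simp only [mfgEta, meanSlope, meanSqSlope]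
    linarith
  have := discrim_le_zero key
  rw [discrim] at this
  linarith

theorem meanSlope_nonneg (h : IsRegularMFG T L σ r ε u m f) (hL : 0 < L) {t : ℝ}
    (ht : t ∈ Icc 0 T) (hux : ∀ x ∈ Icc 0 L, 0 ≤ pdx u t x) : 0 ≤ meanSlope L u m t :=
  intervalIntegral.integral_nonneg hL.le fun x hx => mul_nonneg (hux x hx) (h.m_nonneg t ht x hx)

theorem meanSqSlope_nonneg (h : IsRegularMFG T L σ r ε u m f) (hL : 0 < L) {t : ℝ}
    (ht : t ∈ Icc 0 T) : 0 ≤ meanSqSlope L u m t :=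
  intervalIntegral.integral_nonneg hL.le fun x hx =>
    mul_nonneg (sq_nonneg _) (h.m_nonneg t ht x hx)

theorem f_sq_mul_eta_le (h : IsRegularMFG T L σ r ε u m f) (hL : 0 < L) (hε : 0 ≤ ε)
    (hη : mfgEta L m 0 = 1) {t : ℝ} (ht : t ∈ Icc 0 T) :
    f t ^ 2 * mfgEta L m t ≤ (2 + ε) + ε / (1 + ε) * meanSqSlope L u m t := by
  have h1 := h.meanSlope_sq_le hL ht
  have h2 := h.meanSqSlope_nonneg hL ht
  have h3 := h.eta_nonneg hL ht
  have h4 := (h.eta_le hL ht).trans hη.le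
  have h5 := h.f_eq t ht
  change _ = 2 + ε * meanSlope L u m t at h5
  generalize f t = F at *
  generalize mfgEta L m t = y at *
  generalize meanSlope L u m t = p at *
  generalize meanSqSlope L u m t = Q at *
  have hy : 0 ≤ ε * y := mul_nonneg hε h3
  have hD : 0 < (2 + ε * y)^2 := by positivity
  have e1 : 0 < 1 + ε := by linarith
  have young : (2 + ε * p)^2 ≤ (2 + ε) * 4 + (2 + ε) / (1 + ε) * (ε^2 * p^2) := by
    have : (2 + ε) * 4 + (2 + ε) / (1 + ε) * (ε^2 * p^2) - (2 + ε * p)^2 =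
        (2 * (1 + ε) - ε * p)^2 / (1 + ε) := by
      field_simp
      ring
    have h6 : 0 ≤ (2 * (1 + ε) - ε * p)^2 / (1 + ε) := by positivity
    linarith
  have hmain : F^2 * y * (2 + ε * y)^2 ≤ ((2 + ε) + ε / (1 + ε) * Q) * (2 + ε * y)^2 := by
    have h7 : F^2 * y * (2 + ε * y)^2 = y * (2 + ε * p)^2 := by rw [← h5]; ring
    have h8 := mul_le_mul_of_nonneg_left young h3
    have h9 : y * ((2 + ε) * 4) ≤ (2 + ε) * (2 + ε * y)^2 := by
      have : 4 * y ≤ (2 + ε * y)^2 := by nlinarith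
      nlinarith
    have h10 : y * ((2 + ε) / (1 + ε) * (ε^2 * p^2)) ≤ ε / (1 + ε) * Q * (2 + ε * y)^2 := by
      have h11 : (2 + ε) * y * (ε * y) ≤ (2 + ε * y)^2 := by nlinarith
      have h12 : (2 + ε) * y * ε * p^2 ≤ (2 + ε * y)^2 * Q := by
        calc (2 + ε) * y * ε * p^2 ≤ (2 + ε) * y * ε * (y * Q) :=
              mul_le_mul_of_nonneg_left h1 (by positivity)
          _ = (2 + ε) * y * (ε * y) * Q := by ring
          _ ≤ (2 + ε * y)^2 * Q := mul_le_mul_of_nonneg_right h11 h2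
      have h13 := mul_le_mul_of_nonneg_left h12 (show 0 ≤ ε / (1 + ε) by positivity)
      calc y * ((2 + ε) / (1 + ε) * (ε^2 * p^2))
          = ε / (1 + ε) * ((2 + ε) * y * ε * p^2) := by ring
        _ ≤ _ := h13
        _ = _ := by ring
    rw [h7]
    linarith
  exact le_of_mul_le_mul_right hmain hD

theorem f_nonneg_and_le (h : IsRegularMFG T L σ r ε u m f) (hL : 0 < L) (hε : 0 ≤ ε) {t : ℝ}
    (ht : t ∈ Icc 0 T) (hp : 0 ≤ meanSlope L u m t) :
    0 ≤ f t ∧ f t ≤ 1 + ε / 2 * meanSlope L u m t := by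
  have hy : 0 ≤ ε * mfgEta L m t := mul_nonneg hε (h.eta_nonneg hL ht)
  have h5 := h.f_eq t ht
  change _ = 2 + ε * meanSlope L u m t at h5
  have h6 : 0 ≤ ε * meanSlope L u m t := mul_nonneg hε hp
  have h7 : 0 ≤ f t := by
    refine nonneg_of_mul_nonneg_right (b := f t) (?_ : 0 ≤ (2 + ε * mfgEta L m t) * f t) ?_
    · linarith
    · linarith
  refine ⟨h7, ?_⟩
  have := mul_nonneg hy h7
  linarith

/-- An antiderivative-like majorant of the mean squared slope, bounded in terms of the data. -/
theorem exists_energy_majorant (h : IsRegularMFG T L σ r ε u m f) (hT : 0 < T) (hL : 0 < L)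
    (hr : 0 < r) (hε : 0 ≤ ε) (hη : mfgEta L m 0 = 1) {M : ℝ}
    (hu : ∀ t ∈ Icc 0 T, ∀ x ∈ Icc 0 L, 0 ≤ u t x) (hM : ∀ x ∈ Icc 0 L, u T x ≤ M)
    (hM0 : 0 ≤ M) :
    ∃ Z Z' : ℝ → ℝ, (∀ t ∈ Icc 0 T, HasDerivAt Z (Z' t) t ∧ meanSqSlope L u m t ≤ Z' t) ∧
      0 ≤ Z 0 ∧ Z T ≤ 4 * (1 + ε) * Real.exp (r * T) * (M + (2 + ε) / 4 * T) := by
  set a := 4 * (1 + ε) * Real.exp (r * T) with ha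
  have ha0 : 0 < a := by positivity
  refine ⟨fun t => a * (Real.exp (-(r * t)) * meanValue L u m t + (2 + ε) / 4 * t),
    fun t => a * (Real.exp (-(r * t)) *
      (1/4 * meanSqSlope L u m t - 1/4 * (f t ^ 2 * mfgEta L m t)) + (2 + ε) / 4),
    fun t ht => ⟨?_, ?_⟩, ?_, ?_⟩
  · have h1 : HasDerivAt (fun s => Real.exp (-(r * s))) (-r * Real.exp (-(r * t))) t := by
      simpa [mul_comm] using ((hasDerivAt_id t).const_mul r).neg.exp
    refine (((h1.mul (h.hasDerivAt_meanValue hL ht)).add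
      ((hasDerivAt_id t).const_mul ((2 + ε) / 4))).const_mul a).congr_deriv ?_
    ring
  · have h1 := h.f_sq_mul_eta_le hL hε hη ht
    have hQ := h.meanSqSlope_nonneg hL ht
    have e1 : 0 < 1 + ε := by linarith
    have h2 : ε / (1 + ε) = 1 - 1 / (1 + ε) := by
      field_simp
      ring
    rw [h2] at h1
    have he1 : Real.exp (-(r * t)) ≤ 1 :=
      Real.exp_le_one_iff.2 (neg_nonpos.2 (mul_nonneg hr.le ht.1))
    have he2 : Real.exp (-(r * T)) ≤ Real.exp (-(r * t)) :=
      Real.exp_le_exp.2 (neg_le_neg (mul_le_mul_of_nonneg_left ht.2 hr.le))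
    have hee : Real.exp (r * T) * Real.exp (-(r * T)) = 1 := by
      rw [← Real.exp_add, add_neg_cancel, Real.exp_zero]
    have h3 : 1/4 * (1 / (1 + ε) * meanSqSlope L u m t) - (2 + ε) / 4 ≤
        1/4 * meanSqSlope L u m t - 1/4 * (f t ^ 2 * mfgEta L m t) := by linarith
    have h4 := mul_le_mul_of_nonneg_left h3 (Real.exp_pos (-(r * t))).le
    have h5 : 0 ≤ 1/4 * (1 / (1 + ε) * meanSqSlope L u m t) := by positivity
    have h6 := mul_le_mul_of_nonneg_right he2 h5
    have h7 : 0 ≤ (1 - Real.exp (-(r * t))) * ((2 + ε) / 4) :=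
      mul_nonneg (by linarith) (by positivity)
    have h8 : Real.exp (-(r * T)) * (1/4 * (1 / (1 + ε) * meanSqSlope L u m t)) ≤
        Real.exp (-(r * t)) * (1/4 * meanSqSlope L u m t - 1/4 * (f t ^ 2 * mfgEta L m t))
          + (2 + ε) / 4 := by linarith
    have h9 := mul_le_mul_of_nonneg_left h8 ha0.le
    have h10 : a * (Real.exp (-(r * T)) * (1/4 * (1 / (1 + ε) * meanSqSlope L u m t))) =
        (Real.exp (r * T) * Real.exp (-(r * T))) * meanSqSlope L u m t := by
      rw [ha]
      field_simp
    rw [h10, hee, one_mul] at h9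
    exact h9
  · have h0 : (0:ℝ) ∈ Icc 0 T := left_mem_Icc.2 hT.le
    have h1 : 0 ≤ meanValue L u m 0 := intervalIntegral.integral_nonneg hL.le fun x hx =>
      mul_nonneg (hu 0 h0 x hx) (h.m_nonneg 0 h0 x hx)
    simp only [mul_zero, neg_zero, Real.exp_zero, one_mul, add_zero]
    positivity
  · have hTT : T ∈ Icc 0 T := right_mem_Icc.2 hT.le
    have hm := continuous_space h.m_smooth T
    have hu' := continuous_space h.u_smooth T
    have h1 : meanValue L u m T ≤ M := by
      have h2 : meanValue L u m T ≤ ∫ x in (0:ℝ)..L, M * m T x :=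
        intervalIntegral.integral_mono_on hL.le (Continuous.intervalIntegrable (by fun_prop) _ _)
          (Continuous.intervalIntegrable (by fun_prop) _ _) fun x hx =>
            mul_le_mul_of_nonneg_right (hM x hx) (h.m_nonneg T hTT x hx)
      rw [intervalIntegral.integral_const_mul] at h2
      have h3 := mul_le_mul_of_nonneg_left ((h.eta_le hL hTT).trans hη.le) hM0
      rw [mfgEta] at h3
      linarith
    refine mul_le_mul_of_nonneg_left (add_le_add ?_ le_rfl) ha0.le
    have he1 : Real.exp (-(r * T)) ≤ 1 :=
      Real.exp_le_one_iff.2 (neg_nonpos.2 (mul_nonneg hr.le hT.le))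
    calc Real.exp (-(r * T)) * meanValue L u m T ≤ Real.exp (-(r * T)) * M :=
          mul_le_mul_of_nonneg_left h1 (Real.exp_pos _).le
      _ ≤ 1 * M := mul_le_mul_of_nonneg_right he1 hM0
      _ = M := one_mul M

end IsRegularMFG

theorem mul_half_log_le_entropyDensity_add (s : ℝ) (hs : 0 ≤ s) :
    s * (1/2 * Real.log (1 + s^2)) ≤ entropyDensity s + s := by
  have h1 : 0 ≤ Real.arctan s := Real.arctan_nonneg.2 hs
  unfold entropyDensity
  linarith

/-- Splitting of `p * s` according to whether `s ≤ κ`. -/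
theorem mul_le_add_entropyDensity {κ V p s : ℝ} (hκ : 0 < κ) (hp : 0 ≤ p) (hpV : p ≤ V)
    (hs : 0 ≤ s) :
    p * s ≤ κ * p + V / (1/2 * Real.log (1 + κ^2)) * (entropyDensity s + s) := by
  have h1 := mul_half_log_le_entropyDensity_add s hs
  have h2 : 0 < 1/2 * Real.log (1 + κ^2) := by
    have : 0 < Real.log (1 + κ^2) := Real.log_pos (by nlinarith [sq_pos_of_pos hκ])
    linarith
  have h3 : 0 ≤ Real.log (1 + s^2) := Real.log_nonneg (by nlinarith [sq_nonneg s])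
  have h4 : 0 ≤ entropyDensity s + s := le_trans (by positivity) h1
  have hV : 0 ≤ V := hp.trans hpV
  rcases le_total s κ with h | h
  · have h5 : 0 ≤ V / (1/2 * Real.log (1 + κ^2)) * (entropyDensity s + s) := by positivity
    nlinarith
  · have h6 : Real.log (1 + κ^2) ≤ Real.log (1 + s^2) :=
      Real.log_le_log (by positivity) (by gcongr)
    have h7 : s ≤ (entropyDensity s + s) / (1/2 * Real.log (1 + κ^2)) := by
      rw [le_div_iff₀ h2]
      exact le_trans (by gcongr) h1
    calc p * s ≤ V * ((entropyDensity s + s) / (1/2 * Real.log (1 + κ^2))) := by gcongr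
      _ = V / (1/2 * Real.log (1 + κ^2)) * (entropyDensity s + s) := by ring
      _ ≤ _ := le_add_of_nonneg_left (by positivity)

namespace IsRegularMFG

variable {T L σ r ε : ℝ} {u m : ℝ → ℝ → ℝ} {f : ℝ → ℝ}

theorem entropy_le (h : IsRegularMFG T L σ r ε u m f) (hT : 0 < T) (hL : 0 < L) (hσ : 0 < σ)
    (hε : 0 ≤ ε) (hη : mfgEta L m 0 = 1) {Z Z' : ℝ → ℝ}
    (hZ : ∀ t ∈ Icc 0 T, HasDerivAt Z (Z' t) t ∧ meanSqSlope L u m t ≤ Z' t) (hZ0 : 0 ≤ Z 0) :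
    ∀ t ∈ Icc 0 T, entropy L m t ≤
      entropy L m 0 + 1/(4 * σ^2) * (2 * Z t + (2 + ε) * t) := by
  intro t ht
  choose! d hd hdle using fun t ht => h.hasDerivAt_entropy hL hσ (t := t) ht
  have hanti : AntitoneOn
      (fun s => entropy L m s - 1/(4 * σ^2) * (2 * Z s + (2 + ε) * s)) (Icc 0 T) := by
    refine antitoneOn_of_hasDerivAt_nonpos
      (g' := fun s => d s - 1/(4 * σ^2) * (2 * Z' s + (2 + ε))) (fun s hs => ?_) fun s hs => ?_
    · refine (hd s hs).sub ((((hZ s hs).1.const_mul 2).add ?_).const_mul _)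
      simpa using (hasDerivAt_id s).const_mul (2 + ε)
    · have h1 := h.f_sq_mul_eta_le hL hε hη hs
      have h2 := h.meanSqSlope_nonneg hL hs
      have h3 : ε / (1 + ε) ≤ 1 := (div_le_one (by positivity)).2 (by linarith)
      have h4 : ε / (1 + ε) * meanSqSlope L u m s ≤ 1 * meanSqSlope L u m s := by gcongr
      have h5 := (hZ s hs).2
      have h6 : 1/(4 * σ^2) * (f s ^ 2 * mfgEta L m s + meanSqSlope L u m s) ≤
          1/(4 * σ^2) * (2 * Z' s + (2 + ε)) :=
        mul_le_mul_of_nonneg_left (by linarith) (by positivity)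
      linarith [hdle s hs]
  have h1 := hanti ⟨le_rfl, hT.le⟩ ht ht.1
  simp only [mul_zero, add_zero] at h1
  have h2 : 0 ≤ 1/(4 * σ^2) * (2 * Z 0) := by positivity
  linarith

theorem integral_pdx (h : IsRegularMFG T L σ r ε u m f) (t a b : ℝ) :
    ∫ x in a..b, pdx u t x = u t b - u t a :=
  intervalIntegral.integral_eq_sub_of_hasDerivAt (fun x _ => hasDerivAt_pdx h.u_smooth t x)
    ((continuous_space (contDiff_pdx h.u_smooth) t).intervalIntegrable _ _)

theorem u_le (h : IsRegularMFG T L σ r ε u m f) (hT : 0 < T) (hL : 0 < L) (hr : 0 < r)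
    (hε : 0 ≤ ε) (hη : mfgEta L m 0 = 1) {Z Z' : ℝ → ℝ}
    (hZ : ∀ t ∈ Icc 0 T, HasDerivAt Z (Z' t) t ∧ meanSqSlope L u m t ≤ Z' t) (hZ0 : 0 ≤ Z 0)
    (hu : ∀ t ∈ Icc 0 T, ∀ x ∈ Icc 0 L, 0 ≤ u t x)
    (hux : ∀ t ∈ Icc 0 T, ∀ x ∈ Icc 0 L, 0 ≤ pdx u t x) :
    ∀ t ∈ Icc 0 T, ∀ x ∈ Icc 0 L, u t x ≤ u T L + 1/2 * T + ε^2/8 * Z T := by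
  have hLmem : L ∈ Icc 0 L := ⟨hL.le, le_rfl⟩
  have hTmem : T ∈ Icc 0 T := ⟨hT.le, le_rfl⟩
  have hQ : ∀ t ∈ Icc 0 T, 0 ≤ Z' t := fun t ht =>
    (h.meanSqSlope_nonneg hL ht).trans (hZ t ht).2
  have hZmono := monotoneOn_of_hasDerivAt_nonneg (fun t ht => (hZ t ht).1) hQ
  have hmono : MonotoneOn (fun s => u s L + 1/2 * s + ε^2/8 * Z s) (Icc 0 T) := by
    refine monotoneOn_of_hasDerivAt_nonneg
      (g' := fun s => pdt u s L + 1/2 + ε^2/8 * Z' s) (fun s hs => ?_) fun s hs => ?_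
    · refine ((hasDerivAt_pdt h.u_smooth s L).add ?_).add ((hZ s hs).1.const_mul _)
      simpa using (hasDerivAt_id s).const_mul (1/2 : ℝ)
    · have h1 := h.hjb s hs L hLmem
      have h2 : pdxx u s L ≤ 0 := nonpos_deriv_of_right_min hL (hasDerivAt_pdxx h.u_smooth s L)
        fun x hx => by
          rw [h.ux_bdry s hs]
          exact hux s hs x hx
      rw [h.ux_bdry s hs, sub_zero] at h1
      have h3 := h.meanSlope_nonneg hL hs (hux s hs)
      obtain ⟨h4, h5⟩ := h.f_nonneg_and_le hL hε hs h3
      have h6 := h.meanSlope_sq_le hL hs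
      have h7 : mfgEta L m s * meanSqSlope L u m s ≤ 1 * meanSqSlope L u m s :=
        mul_le_mul_of_nonneg_right ((h.eta_le hL hs).trans hη.le) (h.meanSqSlope_nonneg hL hs)
      have h8 : meanSlope L u m s ^ 2 ≤ Z' s := by linarith [(hZ s hs).2]
      have h9 : f s ^ 2 ≤ (1 + ε/2 * meanSlope L u m s) ^ 2 := by gcongr
      have h10 : ε^2 * meanSlope L u m s ^ 2 ≤ ε^2 * Z' s := by gcongr
      have h11 : σ^2/2 * pdxx u s L ≤ 0 := mul_nonpos_of_nonneg_of_nonpos (by positivity) h2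
      have h12 : 0 ≤ r * u s L := mul_nonneg hr.le (hu s hs L hLmem)
      nlinarith [sq_nonneg (1 - ε/2 * meanSlope L u m s)]
  intro t ht x hx
  have h1 := hmono ht hTmem ht.2
  have h2 : u t x ≤ u t L := by
    refine monotoneOn_of_hasDerivAt_nonneg
      (fun y _ => hasDerivAt_pdx h.u_smooth t y) (hux t ht) hx hLmem hx.2
  have h3 : 0 ≤ Z t := hZ0.trans (hZmono ⟨le_rfl, hT.le⟩ ht ht.1)
  have h4 : 0 ≤ ε^2/8 * Z t := by positivity
  have h5 := ht.1
  simp only at h1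
  linarith

theorem meanSlope_le (h : IsRegularMFG T L σ r ε u m f) (hL : 0 < L) {κ V : ℝ} (hκ : 0 < κ)
    {t : ℝ} (ht : t ∈ Icc 0 T) (hux : ∀ x ∈ Icc 0 L, 0 ≤ pdx u t x)
    (huV : ∀ x ∈ Icc 0 L, pdx u t x ≤ V) :
    meanSlope L u m t ≤ κ * u t L +
      V / (1/2 * Real.log (1 + κ^2)) * (entropy L m t + mfgEta L m t) := by
  have hm := continuous_space h.m_smooth t
  have hux' := continuous_space (contDiff_pdx h.u_smooth) t
  have hE : Continuous fun x => entropyDensity (m t x) :=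
    contDiff_entropyDensity.continuous.comp hm
  have i1 : IntervalIntegrable (pdx u t) volume 0 L := hux'.intervalIntegrable _ _
  have i2 : IntervalIntegrable (fun x => entropyDensity (m t x)) volume 0 L :=
    hE.intervalIntegrable _ _
  have i3 : IntervalIntegrable (m t) volume 0 L := hm.intervalIntegrable _ _
  set c := V / (1/2 * Real.log (1 + κ^2)) with hc
  have hval : ∫ x in (0:ℝ)..L, (κ * pdx u t x + c * (entropyDensity (m t x) + m t x)) =
      κ * u t L + c * (entropy L m t + mfgEta L m t) := by
    rw [intervalIntegral.integral_add (i1.const_mul _) ((i2.add i3).const_mul _),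
      intervalIntegral.integral_const_mul, intervalIntegral.integral_const_mul,
      intervalIntegral.integral_add i2 i3, h.integral_pdx, h.u_bdry t ht, sub_zero]
    rfl
  rw [← hval]
  exact intervalIntegral.integral_mono_on hL.le ((hux'.mul hm).intervalIntegrable _ _)
    (Continuous.intervalIntegrable (by fun_prop) _ _)
    fun x hx => mul_le_add_entropyDensity hκ (hux x hx) (huV x hx) (h.m_nonneg t ht x hx)

theorem exists_max_slope (h : IsRegularMFG T L σ r ε u m f) (hT : 0 < T) (hL : 0 < L) :
    ∃ t₀ ∈ Icc 0 T, ∃ x₀ ∈ Icc 0 L, ∀ t ∈ Icc 0 T, ∀ x ∈ Icc 0 L, pdx u t x ≤ pdx u t₀ x₀ := by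
  obtain ⟨p, hp, hmax⟩ := (isCompact_Icc.prod isCompact_Icc).exists_isMaxOn
    (⟨(0, 0), ⟨le_rfl, hT.le⟩, ⟨le_rfl, hL.le⟩⟩ : (Icc 0 T ×ˢ Icc 0 L).Nonempty)
    (contDiff_pdx h.u_smooth).continuous.continuousOn
  exact ⟨p.1, hp.1, p.2, hp.2, fun t ht x hx => hmax (mk_mem_prod ht hx)⟩

/-- A bound on the slope, from a bound on the value function and on the entropy. -/
theorem slope_le (h : IsRegularMFG T L σ r ε u m f) (hT : 0 < T) (hL : 0 < L) (hσ : 0 < σ)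
    (hr : 0 < r) (hε : 0 ≤ ε) {A U D κ : ℝ} (hA : 0 ≤ A) (hD : 0 ≤ D) (hκ : 0 < κ)
    (hκD : ε * D * Real.exp (U / (2 * σ^2)) ≤ 1/2 * Real.log (1 + κ^2))
    (hu : ∀ t ∈ Icc 0 T, ∀ x ∈ Icc 0 L, 0 ≤ u t x)
    (hux : ∀ t ∈ Icc 0 T, ∀ x ∈ Icc 0 L, 0 ≤ pdx u t x)
    (hU : ∀ t ∈ Icc 0 T, ∀ x ∈ Icc 0 L, u t x ≤ U)
    (hent : ∀ t ∈ Icc 0 T, entropy L m t + mfgEta L m t ≤ D)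
    (hterm : ∀ x ∈ Icc 0 L, u T x ≤ A * x) (hterm' : ∀ x ∈ Icc 0 L, pdx u T x ≤ A) :
    ∀ t ∈ Icc 0 T, ∀ x ∈ Icc 0 L, pdx u t x ≤ 2 * (A * Real.exp (A * L / (2 * σ^2)) +
      (1/2 * (1 + ε/2 * (κ * U)) + 1) * Real.exp (U / (2 * σ^2))) := by
  obtain ⟨t₀, ht₀, x₀, hx₀, hmax⟩ := h.exists_max_slope hT hL
  set V := pdx u t₀ x₀ with hV
  have hV0 : 0 ≤ V := hux t₀ ht₀ x₀ hx₀
  have hLmem : L ∈ Icc 0 L := ⟨hL.le, le_rfl⟩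
  have hU0 : 0 ≤ U := (hu t₀ ht₀ x₀ hx₀).trans (hU t₀ ht₀ x₀ hx₀)
  set ℓ := 1/2 * Real.log (1 + κ^2) with hℓ
  have hℓ0 : 0 < ℓ := by
    have : 0 < Real.log (1 + κ^2) := Real.log_pos (by nlinarith [sq_pos_of_pos hκ])
    positivity
  set e := Real.exp (U / (2 * σ^2)) with he
  have he0 : 0 < e := Real.exp_pos _
  set P := κ * U + V / ℓ * D with hP
  have hP0 : 0 ≤ P := by positivity
  have hp : ∀ t ∈ Icc 0 T, meanSlope L u m t ≤ P := fun t ht => by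
    refine (h.meanSlope_le hL hκ ht (hux t ht) (hmax t ht)).trans ?_
    have h1 := hU t ht L hLmem
    have h2 := hent t ht
    rw [← hℓ, hP]
    gcongr
  have hf := fun t ht => h.f_nonneg_and_le hL hε (t := t) ht (h.meanSlope_nonneg hL ht (hux t ht))
  have hfF : ∀ t ∈ Icc 0 T, f t ≤ 1 + ε/2 * P := fun t ht => by
    refine (hf t ht).2.trans ?_
    have := hp t ht
    gcongr
  have hzero := h.ux_zero_le hT hL hσ hr (fun t ht => (hf t ht).1) hfF (by positivity) hA hU hterm
  rw [← he] at hzero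
  have hexp : 1 ≤ Real.exp (A * L / (2 * σ^2)) := Real.one_le_exp (by positivity)
  have hle := h.ux_le hT hL hr (by positivity)
    (fun x hx => (hterm' x hx).trans ((le_mul_of_one_le_right hA hexp).trans
      (le_add_of_nonneg_right (by positivity)))) hzero t₀ ht₀ x₀ hx₀
  rw [← hV] at hle
  have habs : ε * (V / ℓ * D) * e ≤ V := by
    calc ε * (V / ℓ * D) * e = V * (ε * D * e) / ℓ := by ring
      _ ≤ V * ℓ / ℓ := by gcongr
      _ = V := by field_simp
  intro t ht x hx
  refine (hmax t ht x hx).trans ?_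
  have hsplit : (1/2 * (1 + ε/2 * P) + 1) * e =
      (1/2 * (1 + ε/2 * (κ * U)) + 1) * e + 1/4 * (ε * (V / ℓ * D) * e) := by
    rw [hP]
    ring
  linarith

end IsRegularMFG

theorem exists_half_log_eq {y : ℝ} (hy : 0 < y) :
    ∃ κ : ℝ, 0 < κ ∧ 1/2 * Real.log (1 + κ^2) = y := by
  have h1 : 0 < Real.exp (2 * y) - 1 := sub_pos.2 (Real.one_lt_exp_iff.2 (by positivity))
  refine ⟨√(Real.exp (2 * y) - 1), Real.sqrt_pos.2 h1, ?_⟩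
  rw [Real.sq_sqrt h1.le, add_sub_cancel, Real.log_exp]
  ring

namespace MFGData

variable {T L σ r ε : ℝ} {uT m0 : ℝ → ℝ}

theorem exists_slope_bound (hd : MFGData T L σ r ε uT m0) :
    ∃ A, 0 ≤ A ∧ (∀ x ∈ Icc 0 L, deriv uT x ≤ A) ∧ ∀ x ∈ Icc 0 L, uT x ≤ A * x := by
  have hc : Continuous (deriv uT) := hd.uT_smooth.continuous_deriv (by norm_num)
  have hdiff : Differentiable ℝ uT := hd.uT_smooth.differentiable (by norm_num)
  obtain ⟨A, hA⟩ := isCompact_Icc.bddAbove_image (K := Icc 0 L) hc.continuousOn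
  have hA' : ∀ x ∈ Icc 0 L, deriv uT x ≤ A := fun x hx => hA (mem_image_of_mem _ hx)
  have h0 : (0:ℝ) ∈ Icc 0 L := ⟨le_rfl, hd.hL.le⟩
  refine ⟨A, (hd.uT_deriv_nonneg 0 h0).trans (hA' 0 h0), hA', fun x hx => ?_⟩
  have h1 := antitoneOn_of_hasDerivAt_nonpos (g := fun y => uT y - A * y)
    (g' := fun y => deriv uT y - A * 1)
    (fun y _ => (hdiff y).hasDerivAt.sub ((hasDerivAt_id y).const_mul A))
    (fun y hy => by linarith [hA' y hy]) h0 hx hx.1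
  simp only [hd.uT_zero, mul_zero, sub_zero] at h1
  linarith

end MFGData

theorem IsMFGSolution.pdx_terminal {T L σ r ε : ℝ} {uT m0 : ℝ → ℝ} {u m : ℝ → ℝ → ℝ}
    (h : IsMFGSolution T L σ r ε uT m0 u m) (hd : MFGData T L σ r ε uT m0) :
    ∀ x ∈ Icc 0 L, pdx u T x = deriv uT x := by
  have h1 : EqOn (pdx u T) (deriv uT) (Ioo 0 L) := fun x hx =>
    Filter.EventuallyEq.deriv_eq (by
      filter_upwards [Icc_mem_nhds hx.1 hx.2] with y hy using h.u_term y hy)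
  have h2 := h1.closure (continuous_space (contDiff_pdx h.u_smooth) T)
    (hd.uT_smooth.continuous_deriv (by norm_num))
  rw [closure_Ioo hd.hL.ne] at h2
  exact h2

/-- there is C > 0 depending only on the data such that
|∫₀^L u_x(t,x) m(t,x) dx| ≤ C for all t ∈ [0,T]. -/
theorem mfg_nonlocal_bound (T L σ r ε : ℝ) (uT m0 : ℝ → ℝ)
    (hdata : MFGData T L σ r ε uT m0) :
    ∃ C : ℝ, 0 < C ∧
      ∀ u m : ℝ → ℝ → ℝ, IsMFGSolution T L σ r ε uT m0 u m →
        ∀ t ∈ Icc (0:ℝ) T,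
          |∫ x in (0:ℝ)..L, pdx u t x * m t x| ≤ C := by
  obtain ⟨A, hA, hA', hAx⟩ := hdata.exists_slope_bound
  have hT := hdata.hT
  have hL := hdata.hL
  have hσ := hdata.hσ
  have hr := hdata.hr
  have hε := hdata.hε
  have hLmem : L ∈ Icc 0 L := ⟨hL.le, le_rfl⟩
  obtain ⟨E, hE⟩ : ∃ E, E = 4 * (1 + ε) * Real.exp (r * T) * (A * L + (2 + ε) / 4 * T) := ⟨_, rfl⟩
  have hE0 : 0 ≤ E := by
    rw [hE]
    positivity
  obtain ⟨U, hU⟩ : ∃ U, U = uT L + 1/2 * T + ε^2/8 * E := ⟨_, rfl⟩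
  have hU0 : 0 ≤ U := by
    rw [hU]
    have := hdata.uT_nonneg L hLmem
    positivity
  obtain ⟨D, hD⟩ : ∃ D, D = |∫ x in (0:ℝ)..L, entropyDensity (m0 x)| +
      1/(4 * σ^2) * (2 * E + (2 + ε) * T) + 1 := ⟨_, rfl⟩
  have hD0 : 0 ≤ D := by
    rw [hD]
    positivity
  obtain ⟨κ, hκ, hκD⟩ := exists_half_log_eq
    (y := ε * D * Real.exp (U / (2 * σ^2)) + 1) (by positivity)
  obtain ⟨W, hW⟩ : ∃ W, W = 2 * (A * Real.exp (A * L / (2 * σ^2)) +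
      (1/2 * (1 + ε/2 * (κ * U)) + 1) * Real.exp (U / (2 * σ^2))) := ⟨_, rfl⟩
  have hW0 : 0 ≤ W := by
    rw [hW]
    positivity
  have hℓ0 : 0 < 1/2 * Real.log (1 + κ^2) := by
    rw [hκD]
    positivity
  refine ⟨κ * U + W / (1/2 * Real.log (1 + κ^2)) * D + 1, by positivity, fun u m hsol t ht => ?_⟩
  have h := hsol.isRegular hdata
  have hη := hsol.eta_zero hdata
  have hpdx := hsol.pdx_terminal hdata
  have hu := h.u_nonneg hT hL hσ hr fun x hx => by
    rw [hsol.u_term x hx]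
    exact hdata.uT_nonneg x hx
  have hux := h.ux_nonneg hT hL hr hu fun x hx => by
    rw [hpdx x hx]
    exact hdata.uT_deriv_nonneg x hx
  have huA : ∀ x ∈ Icc 0 L, u T x ≤ A * x := fun x hx => by
    rw [hsol.u_term x hx]
    exact hAx x hx
  obtain ⟨Z, Z', hZ, hZ0, hZT⟩ := h.exists_energy_majorant hT hL hr hε hη (M := A * L) hu
    (fun x hx => (huA x hx).trans (mul_le_mul_of_nonneg_left hx.2 hA)) (by positivity)
  rw [← hE] at hZT
  have hZmono := monotoneOn_of_hasDerivAt_nonneg (fun s hs => (hZ s hs).1)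
    fun s hs => (h.meanSqSlope_nonneg hL hs).trans (hZ s hs).2
  have huU : ∀ s ∈ Icc 0 T, ∀ x ∈ Icc 0 L, u s x ≤ U := fun s hs x hx => by
    refine (h.u_le hT hL hr hε hη hZ hZ0 hu hux s hs x hx).trans ?_
    rw [hsol.u_term L hLmem, hU]
    gcongr
  have hent0 : entropy L m 0 = ∫ x in (0:ℝ)..L, entropyDensity (m0 x) :=
    intervalIntegral.integral_congr fun x hx => by
      rw [uIcc_of_le hL.le] at hx
      simp only [hsol.m_init x hx]
  have hent : ∀ s ∈ Icc 0 T, entropy L m s + mfgEta L m s ≤ D := fun s hs => by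
    have h1 := h.entropy_le hT hL hσ hε hη hZ hZ0 s hs
    have h2 := (h.eta_le hL hs).trans hη.le
    have h3 : Z s ≤ E := (hZmono hs ⟨hT.le, le_rfl⟩ hs.2).trans hZT
    have h4 : 1/(4 * σ^2) * (2 * Z s + (2 + ε) * s) ≤ 1/(4 * σ^2) * (2 * E + (2 + ε) * T) := by
      have := hs.2
      gcongr
    rw [hent0] at h1
    rw [hD]
    linarith [le_abs_self (∫ x in (0:ℝ)..L, entropyDensity (m0 x))]
  have hslope := h.slope_le hT hL hσ hr hε hA hD0 hκ (by linarith) hu hux huU hent huA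
    fun x hx => by
      rw [hpdx x hx]
      exact hA' x hx
  rw [← hW] at hslope
  have h1 := h.meanSlope_le hL hκ ht (hux t ht) (hslope t ht)
  have h2 : κ * u t L + W / (1/2 * Real.log (1 + κ^2)) * (entropy L m t + mfgEta L m t) ≤
      κ * U + W / (1/2 * Real.log (1 + κ^2)) * D :=
    add_le_add (mul_le_mul_of_nonneg_left (huU t ht L hLmem) hκ.le)
      (mul_le_mul_of_nonneg_left (hent t ht) (by positivity))
  change |meanSlope L u m t| ≤ _
  rw [abs_of_nonneg (h.meanSlope_nonneg hL ht (hux t ht))]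
  linarith
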